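/- arXiv:1503.04826 — 2 statements merged into one kernel-verified Lean document; each statement's English description precedes it below -/
import Mathlib

section
/- (Convergence of minimizers.) Let ε_k → 0 and for each k let μ_k ∈ P_2(ℝ^d) be a minimizer of E_{ε_k} over P_2(ℝ^d). Then there exist a subsequence (k_j), translation vectors y_j ∈ ℝ^d, and μ ∈ P_2(ℝ^d) such that: (a) the translated measures μ_{k_j}(· + y_j) converge to μ weakly-* and their second moments converge to the second moment of μ (equivalently, they converge to μ in the 2-Wasserstein sense), and (b) μ minimizes E over P_2(ℝ^d). -/
open MeasureTheory Filter
open scoped ENNReal Topology NNReal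

noncomputable section

/-- Power-law interaction kernel `K(x) = |x|^q/q - |x|^p/p` (real-valued). -/
noncomputable def Kfun (d : ℕ) (p q : ℝ) (x : EuclideanSpace ℝ (Fin d)) : ℝ :=
  ‖x‖ ^ q / q - ‖x‖ ^ p / p

/-- Power-law interaction kernel, valued in `[0,∞]` (note `K 0 = ∞` when `p < 0 < q`). -/
noncomputable def KE (d : ℕ) (p q : ℝ) (x : EuclideanSpace ℝ (Fin d)) : ℝ≥0∞ :=
  (‖x‖₊ : ℝ≥0∞) ^ q / ENNReal.ofReal q + (‖x‖₊ : ℝ≥0∞) ^ p / ENNReal.ofReal (-p)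

/-- Repulsive part `K^r(x) = -|x|^p/p` of the power-law kernel, valued in `[0,∞]`. -/
noncomputable def KrE (d : ℕ) (p : ℝ) (x : EuclideanSpace ℝ (Fin d)) : ℝ≥0∞ :=
  (‖x‖₊ : ℝ≥0∞) ^ p / ENNReal.ofReal (-p)

/-- Rescaled mollifier `φ_ε(x) = ε^{-d} φ(x/ε)`. -/
noncomputable def scaled (d : ℕ) (φ : EuclideanSpace ℝ (Fin d) → ℝ) (ε : ℝ)
    (x : EuclideanSpace ℝ (Fin d)) : ℝ :=
  (ε ^ d)⁻¹ * φ (ε⁻¹ • x)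

/-- Mollifier hypotheses (M1)–(M3). -/
def IsMollifier (d : ℕ) (φ : EuclideanSpace ℝ (Fin d) → ℝ) : Prop :=
  ContDiff ℝ (⊤ : ℕ∞) φ ∧ (∀ x y, ‖x‖ = ‖y‖ → φ x = φ y) ∧ (∀ x, 0 ≤ φ x) ∧
    (∫ x, φ x) = 1 ∧
    ∃ C : ℝ, 0 < C ∧ ∃ l : ℝ, max (2 * (d : ℝ) + 1) 4 ≤ l ∧
      ∀ x : EuclideanSpace ℝ (Fin d), x ≠ 0 → φ x ≤ C * ‖x‖ ^ (-l)

/-- Regularized kernel `K_ε = φ_ε * K * φ_ε` (real-valued). -/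
noncomputable def Kreg (d : ℕ) (p q : ℝ) (φ : EuclideanSpace ℝ (Fin d) → ℝ) (ε : ℝ)
    (x : EuclideanSpace ℝ (Fin d)) : ℝ :=
  ∫ y, ∫ z, scaled d φ ε y * Kfun d p q (x - y - z) * scaled d φ ε z

/-- Double mollification `g * K * g` of a `[0,∞]`-valued kernel by a nonnegative function. -/
noncomputable def convE (d : ℕ) (g : EuclideanSpace ℝ (Fin d) → ℝ)
    (K : EuclideanSpace ℝ (Fin d) → ℝ≥0∞) (x : EuclideanSpace ℝ (Fin d)) : ℝ≥0∞ :=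
  ∫⁻ y, ∫⁻ z, ENNReal.ofReal (g y) * K (x - y - z) * ENNReal.ofReal (g z)

/-- Interaction energy `E(μ) = ∬ K(x-y) dμ(x) dμ(y)` for a `[0,∞]`-valued kernel. -/
noncomputable def energyE (d : ℕ) (K : EuclideanSpace ℝ (Fin d) → ℝ≥0∞)
    (μ : Measure (EuclideanSpace ℝ (Fin d))) : ℝ≥0∞ :=
  ∫⁻ x, ∫⁻ y, K (x - y) ∂μ ∂μ

/-- Regularized interaction energy `E_ε(μ) = ∬ K_ε(x-y) dμ(x) dμ(y)`. -/
noncomputable def energyReg (d : ℕ) (p q : ℝ) (φ : EuclideanSpace ℝ (Fin d) → ℝ) (ε : ℝ)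
    (μ : Measure (EuclideanSpace ℝ (Fin d))) : ℝ≥0∞ :=
  energyE d (fun x => ENNReal.ofReal (Kreg d p q φ ε x)) μ

/-- Real-valued interaction energy. -/
noncomputable def energyReal (d : ℕ) (p q : ℝ) (μ : Measure (EuclideanSpace ℝ (Fin d))) : ℝ :=
  ∫ x, ∫ y, Kfun d p q (x - y) ∂μ ∂μ

/-- Borel probability measure with finite second moment. -/
def IsP2 (d : ℕ) (μ : Measure (EuclideanSpace ℝ (Fin d))) : Prop :=
  IsProbabilityMeasure μ ∧ (∫⁻ x, (‖x‖₊ : ℝ≥0∞) ^ 2 ∂μ) < ⊤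

/-- The heat kernel `ψ_ε(x) = (4πε)^{-d/2} e^{-|x|²/(4ε)}`. -/
noncomputable def heat (d : ℕ) (ε : ℝ) (x : EuclideanSpace ℝ (Fin d)) : ℝ :=
  (4 * Real.pi * ε) ^ (-(d : ℝ) / 2) * Real.exp (-‖x‖ ^ 2 / (4 * ε))

/-- Weak-* convergence of a sequence of measures: convergence of integrals of all bounded
continuous functions. -/
def WeakStarTendsto (d : ℕ) (μ : ℕ → Measure (EuclideanSpace ℝ (Fin d)))
    (ν : Measure (EuclideanSpace ℝ (Fin d))) : Prop :=
  ∀ f : EuclideanSpace ℝ (Fin d) → ℝ, Continuous f → (∃ M : ℝ, ∀ x, |f x| ≤ M) →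
    Tendsto (fun k => ∫ x, f x ∂(μ k)) atTop (𝓝 (∫ x, f x ∂ν))

/-- `μ` is absolutely continuous (w.r.t. Lebesgue) with density bounded by `R`. -/
def HasBddDensity (d : ℕ) (μ : Measure (EuclideanSpace ℝ (Fin d))) (R : ℝ) : Prop :=
  ∃ ρ : EuclideanSpace ℝ (Fin d) → ℝ≥0∞, Measurable ρ ∧ μ = volume.withDensity ρ ∧
    ∀ᵐ x ∂(volume : Measure (EuclideanSpace ℝ (Fin d))), ρ x ≤ ENNReal.ofReal R

/-- Explicit gradient `∇K(x) = x|x|^{q-2} - x|x|^{p-2}` of the power-law kernel. -/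
noncomputable def gradK (d : ℕ) (p q : ℝ) (x : EuclideanSpace ℝ (Fin d)) :
    EuclideanSpace ℝ (Fin d) :=
  (‖x‖ ^ (q - 2)) • x - (‖x‖ ^ (p - 2)) • x

/-- The log-Lipschitz modulus of convexity `ω`. -/
noncomputable def omegaMod (x : ℝ) : ℝ :=
  if x ≤ Real.exp (-1 - Real.sqrt 2) then x * |Real.log x|
  else Real.sqrt (x ^ 2 + 2 * (1 + Real.sqrt 2) * Real.exp (-1 - Real.sqrt 2) * x)

/-- Support of a measure: points all of whose neighborhoods have positive measure. -/
def msupport (d : ℕ) (μ : Measure (EuclideanSpace ℝ (Fin d))) :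
    Set (EuclideanSpace ℝ (Fin d)) :=
  {x | ∀ r : ℝ, 0 < r → 0 < μ (Metric.ball x r)}

/-- The measure `μ * ψ_δ` obtained by mollifying `μ` with the heat kernel at scale `δ`. -/
noncomputable def heatMollified (d : ℕ) (μ : Measure (EuclideanSpace ℝ (Fin d))) (δ : ℝ) :
    Measure (EuclideanSpace ℝ (Fin d)) :=
  volume.withDensity fun x => ENNReal.ofReal (∫ y, heat d δ (x - y) ∂μ)

/-- Shorthand for Euclidean space. -/
abbrev Eu (d : ℕ) := EuclideanSpace ℝ (Fin d)

lemma pow_add_le_four {q : ℝ} (hq1 : 0 < q) (hq2 : q ≤ 2) (a b : ℝ≥0∞) :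
    (a + b) ^ q ≤ 4 * (a ^ q + b ^ q) := by
  have key : ∀ a b : ℝ≥0∞, a ≤ b → (a + b) ^ q ≤ 4 * (a ^ q + b ^ q) := by
    intro a b hab
    calc (a + b) ^ q ≤ (2 * b) ^ q := by
          apply ENNReal.rpow_le_rpow _ hq1.le
          rw [two_mul]; gcongr
      _ = 2 ^ q * b ^ q := ENNReal.mul_rpow_of_nonneg _ _ hq1.le
      _ ≤ 2 ^ (2 : ℝ) * b ^ q := by
          gcongr
          exact one_le_two
      _ = 4 * b ^ q := by norm_num
      _ ≤ _ := by gcongr; exact le_add_self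
  rcases le_total a b with h | h
  · exact key a b h
  · rw [add_comm a b, add_comm (a ^ q)]; exact key b a h

lemma rpow_le_one_add_sq {q : ℝ} (hq1 : 0 < q) (hq2 : q ≤ 2) (a : ℝ≥0∞) :
    a ^ q ≤ 1 + a ^ 2 := by
  rcases le_total a 1 with h | h
  · calc a ^ q ≤ 1 := ENNReal.rpow_le_one h hq1.le
      _ ≤ _ := le_self_add
  · calc a ^ q ≤ a ^ (2 : ℝ) := ENNReal.rpow_le_rpow_of_exponent_le h hq2
      _ = a ^ 2 := by norm_num
      _ ≤ _ := le_add_self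

lemma lintegral_affine {d : ℕ} (g : Eu d → ℝ≥0∞) {a : ℝ} (ha : a ≠ 0) (b : Eu d) :
    ∫⁻ z, g (b - a • z) = ENNReal.ofReal |(a ^ d)⁻¹| * ∫⁻ z, g z := by
  have h1 : ∫⁻ z, g (b - z) ∂(Measure.map (fun x : Eu d => a • x) volume)
      = ∫⁻ z, g (b - a • z) :=
    MeasurableEmbedding.lintegral_map (measurableEmbedding_const_smul₀ ha) _
  rw [← h1, Measure.map_addHaar_smul _ ha, lintegral_smul_measure,
    lintegral_sub_left_eq_self]
  simp

lemma lint_ball_rpow_lt_top {d : ℕ} (hd : 3 ≤ d) {p : ℝ} (hp1 : 2 - (d : ℝ) ≤ p) :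
    ∫⁻ w in Metric.ball (0 : Eu d) 1, (‖w‖₊ : ℝ≥0∞) ^ p < ⊤ := by
  have h1 : IntegrableOn (fun x : Eu d => ‖x‖ ^ p) (Metric.ball (0 : Eu d) 1) volume := by
    have : Nonempty (Fin d) := ⟨⟨0, by omega⟩⟩
    have : Nontrivial (Eu d) := inferInstance
    rw [integrableOn_fun_norm_addHaar volume (f := fun t => t ^ p)]
    have h2 : IntegrableOn (fun x : ℝ => x ^ ((d : ℝ) - 1 + p)) (Set.Ioo 0 1) volume := by
      have := intervalIntegral.intervalIntegrable_rpow' (a := 0) (b := 1)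
        (r := (d : ℝ) - 1 + p) (by linarith)
      rw [intervalIntegrable_iff_integrableOn_Ioo_of_le zero_le_one] at this
      exact this
    refine h2.congr_fun ?_ measurableSet_Ioo
    intro y hy
    simp only [finrank_euclideanSpace, Fintype.card_fin, smul_eq_mul]
    rw [Real.rpow_add hy.1, ← Real.rpow_natCast, Nat.cast_sub (by omega)]
    simp
  have h3 := h1.setLIntegral_lt_top
  refine lt_of_eq_of_lt ?_ h3
  apply lintegral_congr_ae
  apply ae_restrict_of_ae
  have : Nonempty (Fin d) := ⟨⟨0, by omega⟩⟩
  have : Nontrivial (Eu d) := inferInstance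
  filter_upwards [Measure.ae_ne volume (0 : Eu d)] with x hx
  rw [← ENNReal.ofReal_rpow_of_pos (norm_pos_iff.2 hx), ofReal_norm]
  rfl

lemma measurable_KE {d : ℕ} {p q : ℝ} : Measurable (KE d p q) := by
  unfold KE; fun_prop

lemma continuous_KE {d : ℕ} {p q : ℝ} (hp2 : p < 0) (hq1 : 0 < q) : Continuous (KE d p q) := by
  unfold KE
  have hq : ENNReal.ofReal q ≠ 0 := by simpa using hq1
  have hp : ENNReal.ofReal (-p) ≠ 0 := by simpa using hp2
  have hn : Continuous (fun x : Eu d => (‖x‖₊ : ℝ≥0∞)) :=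
    ENNReal.continuous_coe.comp continuous_nnnorm
  exact ((ENNReal.continuous_div_const _ hq).comp (ENNReal.continuous_rpow_const.comp hn)).add
    ((ENNReal.continuous_div_const _ hp).comp (ENNReal.continuous_rpow_const.comp hn))

/-- the quantitative density bound -/
def Good (d : ℕ) (η : Measure (Eu d)) (C : ℝ) : Prop :=
  0 < C ∧ ∀ r : ℝ, 0 ≤ r → ∀ A : Set (Eu d), MeasurableSet A → (∀ z ∈ A, r ≤ ‖z‖) →
    η A ≤ ENNReal.ofReal (C / (1 + r) ^ (d + 1)) * volume A

lemma Good.lint {d : ℕ} {η : Measure (Eu d)} {C : ℝ} (h : Good d η C) {r : ℝ} (hr : 0 ≤ r)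
    {T : Set (Eu d)} (hT : MeasurableSet T) (hTr : ∀ z ∈ T, r ≤ ‖z‖) (f : Eu d → ℝ≥0∞) :
    ∫⁻ z in T, f z ∂η ≤ ENNReal.ofReal (C / (1 + r) ^ (d + 1)) * ∫⁻ z in T, f z := by
  have : η.restrict T ≤ ENNReal.ofReal (C / (1 + r) ^ (d + 1)) • volume.restrict T := by
    rw [Measure.le_iff]
    intro A hA
    rw [Measure.restrict_apply hA, Measure.smul_apply, Measure.restrict_apply hA, smul_eq_mul]
    exact h.2 r hr _ (hA.inter hT) (fun z hz => hTr z hz.2)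
  calc _ ≤ ∫⁻ z, f z ∂(ENNReal.ofReal (C / (1 + r) ^ (d + 1)) • volume.restrict T) :=
        lintegral_mono' this le_rfl
    _ = _ := by rw [lintegral_smul_measure, smul_eq_mul]

/-- the mollifier as a measure -/
def mm (d : ℕ) (φ : Eu d → ℝ) : Measure (Eu d) :=
  volume.withDensity (fun z => ENNReal.ofReal (φ z))

lemma moll_decay {d : ℕ} (hd : 3 ≤ d) {φ : Eu d → ℝ} (hφ : IsMollifier d φ) :
    ∃ C : ℝ, 0 < C ∧ ∀ z, φ z ≤ C / (1 + ‖z‖) ^ (d + 3) := by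
  obtain ⟨hc, -, hnn, -, C, hC, l, hl, hdec⟩ := hφ
  have hcont : Continuous φ := hc.continuous
  obtain ⟨M, hM⟩ := (isCompact_closedBall (0 : Eu d) 1).exists_bound_of_continuousOn
    hcont.continuousOn
  have hM0 : 0 ≤ M := (norm_nonneg _).trans (hM 0 (by simp))
  refine ⟨(M + C) * 2 ^ (d + 3), by positivity, fun z => ?_⟩
  rw [le_div_iff₀ (by positivity)]
  have hd' : (3 : ℝ) ≤ d := by exact_mod_cast hd
  have hl' : (d : ℝ) + 3 ≤ l := by
    have := le_trans (le_max_left _ _) hl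
    linarith
  rcases le_total ‖z‖ 1 with h | h
  · have h1 : φ z ≤ M := (le_abs_self _).trans (hM z (by simpa using h))
    have h2 : φ z ≤ M + C := by linarith
    have h3 : 1 + ‖z‖ ≤ 2 := by linarith
    gcongr
  · have hz : z ≠ 0 := by
      rintro rfl; norm_num at h
    have h1 : φ z ≤ C * ‖z‖ ^ (-((d : ℝ) + 3)) := by
      refine (hdec z hz).trans ?_
      gcongr
    have hz0 : 0 < ‖z‖ := by linarith
    calc φ z * (1 + ‖z‖) ^ (d + 3) ≤ C * ‖z‖ ^ (-((d : ℝ) + 3)) * (2 * ‖z‖) ^ (d + 3) := by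
          have := hnn z
          gcongr
          linarith
      _ = C * 2 ^ (d + 3) := by
          have : ‖z‖ ^ (-((d : ℝ) + 3)) = (‖z‖ ^ (d + 3))⁻¹ := by
            rw [Real.rpow_neg hz0.le]
            congr 1
            exact_mod_cast Real.rpow_natCast ‖z‖ (d + 3)
          rw [this, mul_pow]
          field_simp
      _ ≤ _ := by gcongr; linarith

lemma moll_measurable {d : ℕ} {φ : Eu d → ℝ} (hφ : IsMollifier d φ) : Measurable φ :=
  hφ.1.continuous.measurable

lemma mm_prob {d : ℕ} {φ : Eu d → ℝ} (hφ : IsMollifier d φ) : IsProbabilityMeasure (mm d φ) := by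
  have hint : Integrable φ volume := by
    by_contra h
    have := hφ.2.2.2.1
    rw [integral_undef h] at this
    norm_num at this
  constructor
  rw [mm, withDensity_apply _ MeasurableSet.univ, Measure.restrict_univ,
    ← ofReal_integral_eq_lintegral_ofReal hint (Eventually.of_forall hφ.2.2.1), hφ.2.2.2.1]
  simp

lemma mm_good {d : ℕ} (hd : 3 ≤ d) {φ : Eu d → ℝ} (hφ : IsMollifier d φ) :
    ∃ C, Good d (mm d φ) C := by
  obtain ⟨C, hC, h⟩ := moll_decay hd hφ
  refine ⟨C, hC, fun r hr A hA hAr => ?_⟩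
  rw [mm, withDensity_apply _ hA]
  calc ∫⁻ z in A, ENNReal.ofReal (φ z) ≤ ∫⁻ z in A, ENNReal.ofReal (C / (1 + r) ^ (d + 1)) := by
        apply setLIntegral_mono' hA
        intro z hz
        apply ENNReal.ofReal_le_ofReal
        refine (h z).trans ?_
        have := hAr z hz
        calc C / (1 + ‖z‖) ^ (d + 3) ≤ C / (1 + ‖z‖) ^ (d + 1) := by
              gcongr
              · linarith [norm_nonneg z]
              · omega
          _ ≤ _ := by gcongr
    _ = _ := by simp

lemma mm_moment {d : ℕ} (hd : 3 ≤ d) {φ : Eu d → ℝ} (hφ : IsMollifier d φ) :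
    ∫⁻ z, (‖z‖₊ : ℝ≥0∞) ^ 2 ∂(mm d φ) < ⊤ := by
  obtain ⟨C, hC, h⟩ := moll_decay hd hφ
  have hm := moll_measurable hφ
  rw [mm, lintegral_withDensity_eq_lintegral_mul _ (by fun_prop) (by fun_prop)]
  have hfin := finite_integral_one_add_norm (E := Eu d) (μ := volume) (r := (d : ℝ) + 1)
    (by simp)
  calc ∫⁻ z : Eu d, ENNReal.ofReal (φ z) * (‖z‖₊ : ℝ≥0∞) ^ 2
      ≤ ∫⁻ z, ENNReal.ofReal C * ENNReal.ofReal ((1 + ‖z‖) ^ (-((d : ℝ) + 1))) := by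
        apply lintegral_mono
        intro z
        beta_reduce
        have e : (‖z‖₊ : ℝ≥0∞) ^ 2 = ENNReal.ofReal (‖z‖ ^ 2) := by
          rw [ENNReal.ofReal_pow (norm_nonneg _), ofReal_norm]; rfl
        rw [e, ← ENNReal.ofReal_mul (hφ.2.2.1 z), ← ENNReal.ofReal_mul hC.le]
        apply ENNReal.ofReal_le_ofReal
        have e2 : (1 + ‖z‖) ^ (-((d : ℝ) + 1)) = ((1 + ‖z‖) ^ (d + 1))⁻¹ := by
          rw [Real.rpow_neg (by positivity)]
          congr 1
          exact_mod_cast Real.rpow_natCast (1 + ‖z‖) (d + 1)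
        rw [e2]
        calc φ z * ‖z‖ ^ 2 ≤ C / (1 + ‖z‖) ^ (d + 3) * (1 + ‖z‖) ^ 2 := by
              have := h z
              gcongr
              linarith [norm_nonneg z]
          _ = _ := by
              rw [show d + 3 = (d + 1) + 2 from rfl, pow_add]
              field_simp
    _ < ⊤ := by
        rw [lintegral_const_mul' _ _ ENNReal.ofReal_ne_top]
        exact ENNReal.mul_lt_top ENNReal.ofReal_lt_top hfin

/-- law of the sum of two independent mollifier variables -/
def m2 (d : ℕ) (φ : Eu d → ℝ) : Measure (Eu d) := (mm d φ).conv (mm d φ)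

lemma m2_prob {d : ℕ} {φ : Eu d → ℝ} (hφ : IsMollifier d φ) : IsProbabilityMeasure (m2 d φ) := by
  have := mm_prob hφ
  unfold m2; infer_instance

lemma m2_moment {d : ℕ} (hd : 3 ≤ d) {φ : Eu d → ℝ} (hφ : IsMollifier d φ) :
    ∫⁻ z, (‖z‖₊ : ℝ≥0∞) ^ 2 ∂(m2 d φ) < ⊤ := by
  have := mm_prob hφ
  have hM := mm_moment hd hφ
  rw [m2, Measure.lintegral_conv (by fun_prop)]
  set M := ∫⁻ z, (‖z‖₊ : ℝ≥0∞) ^ 2 ∂(mm d φ) with hMdef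
  calc ∫⁻ x, ∫⁻ y, (‖x + y‖₊ : ℝ≥0∞) ^ 2 ∂(mm d φ) ∂(mm d φ)
      ≤ ∫⁻ x, ∫⁻ y, 4 * ((‖x‖₊ : ℝ≥0∞) ^ 2 + (‖y‖₊ : ℝ≥0∞) ^ 2) ∂(mm d φ) ∂(mm d φ) := by
        apply lintegral_mono; intro x
        apply lintegral_mono; intro y
        have h1 : (‖x + y‖₊ : ℝ≥0∞) ≤ ‖x‖₊ + ‖y‖₊ := by exact_mod_cast nnnorm_add_le x y
        have h2 := pow_add_le_four (q := 2) (by norm_num) le_rfl (‖x‖₊ : ℝ≥0∞) (‖y‖₊ : ℝ≥0∞)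
        simp only [ENNReal.rpow_ofNat] at h2
        exact le_trans (pow_le_pow_left' h1 2) h2
    _ = ∫⁻ x, 4 * ((‖x‖₊ : ℝ≥0∞) ^ 2 + M) ∂(mm d φ) := by
        congr 1; ext x
        rw [lintegral_const_mul _ (by fun_prop), lintegral_add_left (by fun_prop), ← hMdef]
        simp
    _ = 4 * (M + M) := by
        rw [lintegral_const_mul _ (by fun_prop), lintegral_add_left (by fun_prop), ← hMdef]
        simp
    _ < ⊤ := ENNReal.mul_lt_top (by norm_num) (ENNReal.add_lt_top.2 ⟨hM, hM⟩)

lemma m2_good {d : ℕ} (hd : 3 ≤ d) {φ : Eu d → ℝ} (hφ : IsMollifier d φ) :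
    ∃ C, Good d (m2 d φ) C := by
  have := mm_prob hφ
  obtain ⟨C, hC, h⟩ := mm_good hd hφ
  refine ⟨2 * (C * 2 ^ (d + 1)), by positivity, fun r hr A hA hAr => ?_⟩
  have hmeas : MeasurableSet ((fun z : Eu d × Eu d => z.1 + z.2) ⁻¹' A) := by
    exact (measurable_fst.add measurable_snd) hA
  set S : Set (Eu d) := {z | r / 2 ≤ ‖z‖} with hS
  have hSm : MeasurableSet S := measurableSet_le measurable_const measurable_norm
  set c := ENNReal.ofReal (C / (1 + r / 2) ^ (d + 1)) with hc
  have hb : ∀ w : Eu d, mm d φ ({z | z + w ∈ A} ∩ S) ≤ c * volume A := by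
    intro w
    have hm : MeasurableSet {z : Eu d | z + w ∈ A} := (measurable_id.add_const w) hA
    refine (h (r / 2) (by positivity) _ (hm.inter hSm) (fun z hz => hz.2)).trans ?_
    refine mul_le_mul_right ?_ c
    calc volume ({z | z + w ∈ A} ∩ S) ≤ volume ((fun z => z + w) ⁻¹' A) :=
          measure_mono Set.inter_subset_left
      _ = volume A := measure_preimage_add_right _ _ _
  rw [m2, Measure.conv, Measure.map_apply (by fun_prop) hA]
  have hsub : ((fun z : Eu d × Eu d => z.1 + z.2) ⁻¹' A) ⊆
      (((fun z : Eu d × Eu d => z.1 + z.2) ⁻¹' A) ∩ (Prod.fst ⁻¹' S)) ∪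
      (((fun z : Eu d × Eu d => z.1 + z.2) ⁻¹' A) ∩ (Prod.snd ⁻¹' S)) := by
    rintro ⟨y, z⟩ hyz
    have h1 : r ≤ ‖y + z‖ := hAr _ hyz
    have h2 := norm_add_le y z
    rcases le_total (r / 2) ‖y‖ with h3 | h3
    · exact Or.inl ⟨hyz, h3⟩
    · refine Or.inr ⟨hyz, ?_⟩
      change r / 2 ≤ ‖z‖
      linarith
  have hfst : MeasurableSet
      (((fun z : Eu d × Eu d => z.1 + z.2) ⁻¹' A) ∩ (Prod.fst ⁻¹' S)) :=
    hmeas.inter (measurable_fst hSm)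
  have hsnd : MeasurableSet
      (((fun z : Eu d × Eu d => z.1 + z.2) ⁻¹' A) ∩ (Prod.snd ⁻¹' S)) :=
    hmeas.inter (measurable_snd hSm)
  refine (measure_mono hsub).trans ((measure_union_le _ _).trans ?_)
  have b1 : ((mm d φ).prod (mm d φ))
      (((fun z : Eu d × Eu d => z.1 + z.2) ⁻¹' A) ∩ (Prod.fst ⁻¹' S)) ≤ c * volume A := by
    rw [Measure.prod_apply_symm hfst]
    calc _ ≤ ∫⁻ _ : Eu d, c * volume A ∂(mm d φ) := by
          apply lintegral_mono; intro w
          exact hb w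
      _ = _ := by simp
  have b2 : ((mm d φ).prod (mm d φ))
      (((fun z : Eu d × Eu d => z.1 + z.2) ⁻¹' A) ∩ (Prod.snd ⁻¹' S)) ≤ c * volume A := by
    rw [Measure.prod_apply hsnd]
    calc _ ≤ ∫⁻ _ : Eu d, c * volume A ∂(mm d φ) := by
          apply lintegral_mono; intro w
          refine le_trans (measure_mono ?_) (hb w)
          rintro z ⟨hz1, hz2⟩
          refine ⟨?_, hz2⟩
          change z + w ∈ A
          rw [add_comm]
          exact hz1
      _ = _ := by simp
  refine (add_le_add b1 b2).trans ?_
  rw [← two_mul, ← mul_assoc]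
  refine mul_le_mul_left ?_ (volume A)
  have e2 : (2 : ℝ≥0∞) = ENNReal.ofReal 2 := by norm_num
  rw [hc, e2, ← ENNReal.ofReal_mul (by norm_num)]
  apply ENNReal.ofReal_le_ofReal
  rw [mul_div_assoc]
  have : (1 + r) ^ (d + 1) ≤ 2 ^ (d + 1) * (1 + r / 2) ^ (d + 1) := by
    rw [← mul_pow]
    gcongr
    linarith
  refine mul_le_mul_of_nonneg_left ?_ (by norm_num)
  rw [div_le_div_iff₀ (by positivity) (by positivity)]
  calc C * (1 + r) ^ (d + 1) ≤ C * (2 ^ (d + 1) * (1 + r / 2) ^ (d + 1)) := by gcongr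
    _ = _ := by ring


/-- the unit ball integral of the repulsive power -/
def Ip (d : ℕ) (p : ℝ) : ℝ≥0∞ := ∫⁻ w in Metric.ball (0 : Eu d) 1, (‖w‖₊ : ℝ≥0∞) ^ p

lemma coe_nnnorm_eq {d : ℕ} (x : Eu d) : (‖x‖₊ : ℝ≥0∞) = ENNReal.ofReal ‖x‖ :=
  (ofReal_norm x).symm

lemma vol_scaled {d : ℕ} {p : ℝ} {ε ρ : ℝ} (hε : 0 < ε) (hρ : 0 < ρ) (x : Eu d) :
    ∫⁻ z in {z : Eu d | ‖x - ε • z‖ < ρ}, (‖x - ε • z‖₊ : ℝ≥0∞) ^ p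
      = ENNReal.ofReal (ρ ^ p * (ρ / ε) ^ d) * Ip d p := by
  have hT : MeasurableSet {z : Eu d | ‖x - ε • z‖ < ρ} :=
    measurableSet_lt (by fun_prop) measurable_const
  set g : Eu d → ℝ≥0∞ := (Metric.ball (0 : Eu d) 1).indicator (fun w => (‖w‖₊ : ℝ≥0∞) ^ p) with hg
  have hgI : ∫⁻ w, g w = Ip d p := by
    rw [hg, lintegral_indicator measurableSet_ball]; rfl
  rw [← lintegral_indicator hT]
  have key : ∀ z : Eu d, ({z : Eu d | ‖x - ε • z‖ < ρ}).indicator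
      (fun z => (‖x - ε • z‖₊ : ℝ≥0∞) ^ p) z
      = ENNReal.ofReal (ρ ^ p) * g (ρ⁻¹ • x - (ε / ρ) • z) := by
    intro z
    have hv : x - ε • z = ρ • (ρ⁻¹ • x - (ε / ρ) • z) := by
      rw [smul_sub, smul_smul, smul_smul, mul_inv_cancel₀ hρ.ne', one_smul]
      congr 2
      field_simp
    set u := ρ⁻¹ • x - (ε / ρ) • z with hu
    have hn : ‖x - ε • z‖ = ρ * ‖u‖ := by
      rw [hv, norm_smul, Real.norm_of_nonneg hρ.le]
    by_cases hz : ‖u‖ < 1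
    · have h1 : z ∈ {z : Eu d | ‖x - ε • z‖ < ρ} := by
        change ‖x - ε • z‖ < ρ
        rw [hn]; nlinarith
      have h2 : u ∈ Metric.ball (0 : Eu d) 1 := by simpa using hz
      rw [Set.indicator_of_mem h1, hg, Set.indicator_of_mem h2, coe_nnnorm_eq, hn,
        ENNReal.ofReal_mul hρ.le, ENNReal.mul_rpow_of_ne_top (by simp) (by simp),
        ENNReal.ofReal_rpow_of_pos hρ, coe_nnnorm_eq]
    · have h1 : z ∉ {z : Eu d | ‖x - ε • z‖ < ρ} := by
        change ¬ ‖x - ε • z‖ < ρ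
        rw [hn]; push Not at hz ⊢; nlinarith
      have h2 : u ∉ Metric.ball (0 : Eu d) 1 := by simpa using hz
      rw [Set.indicator_of_notMem h1, hg, Set.indicator_of_notMem h2, mul_zero]
  simp_rw [key]
  rw [lintegral_const_mul' _ _ ENNReal.ofReal_ne_top, lintegral_affine g (by positivity), hgI,
    ← mul_assoc, ← ENNReal.ofReal_mul (by positivity), abs_of_pos (by positivity)]
  congr 3
  rw [← inv_pow, inv_div]

lemma Rnear {d : ℕ} {p : ℝ} {η : Measure (Eu d)} {C : ℝ} (h : Good d η C)
    {ε ρ r : ℝ} (hε : 0 < ε) (hρ : 0 < ρ) (hr : 0 ≤ r) (x : Eu d)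
    (hx : ∀ z : Eu d, ‖x - ε • z‖ < ρ → r ≤ ‖z‖) :
    ∫⁻ z in {z : Eu d | ‖x - ε • z‖ < ρ}, (‖x - ε • z‖₊ : ℝ≥0∞) ^ p ∂η
      ≤ ENNReal.ofReal (C / (1 + r) ^ (d + 1) * (ρ ^ p * (ρ / ε) ^ d)) * Ip d p := by
  have hT : MeasurableSet {z : Eu d | ‖x - ε • z‖ < ρ} :=
    measurableSet_lt (by fun_prop) measurable_const
  have hC := h.1
  refine (h.lint hr hT hx _).trans (le_of_eq ?_)
  rw [vol_scaled hε hρ, ← mul_assoc, ← ENNReal.ofReal_mul (by positivity)]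

lemma far_le {p : ℝ} (hp2 : p < 0) {d : ℕ} {ρ : ℝ} (hρ : 0 < ρ) {v : Eu d} (hv : ρ ≤ ‖v‖) :
    (‖v‖₊ : ℝ≥0∞) ^ p ≤ ENNReal.ofReal (ρ ^ p) := by
  rw [coe_nnnorm_eq, ENNReal.ofReal_rpow_of_pos (by linarith)]
  apply ENNReal.ofReal_le_ofReal
  exact Real.rpow_le_rpow_of_nonpos hρ hv hp2.le

lemma Rsplit {d : ℕ} {p : ℝ} (hp2 : p < 0) {η : Measure (Eu d)} [IsProbabilityMeasure η]
    {C : ℝ} (h : Good d η C)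
    {ε ρ r : ℝ} (hε : 0 < ε) (hρ : 0 < ρ) (hr : 0 ≤ r) (x : Eu d)
    (hx : ∀ z : Eu d, ‖x - ε • z‖ < ρ → r ≤ ‖z‖) :
    ∫⁻ z, (‖x - ε • z‖₊ : ℝ≥0∞) ^ p ∂η ≤ ENNReal.ofReal (ρ ^ p)
      + ENNReal.ofReal (C / (1 + r) ^ (d + 1) * (ρ ^ p * (ρ / ε) ^ d)) * Ip d p := by
  have hT : MeasurableSet {z : Eu d | ‖x - ε • z‖ < ρ} :=
    measurableSet_lt (by fun_prop) measurable_const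
  rw [← lintegral_add_compl _ hT, add_comm]
  refine add_le_add ?_ (Rnear h hε hρ hr x hx)
  calc _ ≤ ∫⁻ z in {z : Eu d | ‖x - ε • z‖ < ρ}ᶜ, ENNReal.ofReal (ρ ^ p) ∂η := by
        apply setLIntegral_mono' hT.compl
        intro z hz
        have hz' : ¬ ‖x - ε • z‖ < ρ := hz
        exact far_le hp2 hρ (not_lt.1 hz')
    _ = ENNReal.ofReal (ρ ^ p) * η ({z : Eu d | ‖x - ε • z‖ < ρ}ᶜ) := by simp
    _ ≤ ENNReal.ofReal (ρ ^ p) * 1 := by gcongr; exact prob_le_one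
    _ = _ := mul_one _

lemma near_far {d : ℕ} {ε : ℝ} (hε : 0 < ε) (x : Eu d) (z : Eu d)
    (hz : ‖x - ε • z‖ < ‖x‖ / 2) : (‖x‖ / 2) / ε ≤ ‖z‖ := by
  rw [div_le_iff₀ hε]
  have h1 : ‖x‖ ≤ ‖x - ε • z‖ + ‖ε • z‖ := by
    calc ‖x‖ = ‖(x - ε • z) + ε • z‖ := by simp
      _ ≤ _ := norm_add_le _ _
  rw [norm_smul, Real.norm_of_nonneg hε.le] at h1
  linarith

lemma Rfin {d : ℕ} {p : ℝ} (hp2 : p < 0) {η : Measure (Eu d)} [IsProbabilityMeasure η]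
    {C : ℝ} (h : Good d η C) {ε : ℝ} (hε : 0 < ε) (x : Eu d) :
    ∫⁻ z, (‖x - ε • z‖₊ : ℝ≥0∞) ^ p ∂η ≤ 1 + ENNReal.ofReal (C * (1 / ε) ^ d) * Ip d p := by
  have := Rsplit hp2 h hε one_pos le_rfl x (fun z _ => norm_nonneg z)
  simpa using this

lemma Rdom {d : ℕ} {p : ℝ} (hp2 : p < 0) {η : Measure (Eu d)} [IsProbabilityMeasure η]
    {C : ℝ} (h : Good d η C) {ε : ℝ} (hε : 0 < ε) {x : Eu d} (hx : x ≠ 0) :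
    ∫⁻ z, (‖x - ε • z‖₊ : ℝ≥0∞) ^ p ∂η ≤
      (1 + ENNReal.ofReal C * Ip d p) * ENNReal.ofReal (2 ^ (-p)) * (‖x‖₊ : ℝ≥0∞) ^ p := by
  have hx0 : 0 < ‖x‖ := norm_pos_iff.2 hx
  have hC := h.1
  set ρ := ‖x‖ / 2 with hρdef
  have hρ : 0 < ρ := by positivity
  set r := ρ / ε with hrdef
  have hr : 0 < r := by positivity
  have h1 := Rsplit hp2 h hε hρ hr.le x (near_far hε x)
  rw [← hrdef] at h1
  have h2 : C / (1 + r) ^ (d + 1) * (ρ ^ p * r ^ d) ≤ C * ρ ^ p := by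
    have h3 : r ^ d ≤ (1 + r) ^ (d + 1) := by
      calc r ^ d ≤ (1 + r) ^ d := by gcongr; linarith
        _ ≤ (1 + r) ^ (d + 1) := by
          apply pow_le_pow_right₀ <;> linarith
    have : 0 < ρ ^ p := by positivity
    rw [div_mul_eq_mul_div, div_le_iff₀ (by positivity), mul_assoc, mul_comm (ρ ^ p) (r ^ d),
      mul_comm (ρ ^ p), ← mul_assoc, ← mul_assoc] at *
    nlinarith [mul_le_mul_of_nonneg_left h3 (mul_pos hC this).le]
  have h4 : ENNReal.ofReal (ρ ^ p) = ENNReal.ofReal (2 ^ (-p)) * (‖x‖₊ : ℝ≥0∞) ^ p := by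
    rw [coe_nnnorm_eq, ENNReal.ofReal_rpow_of_pos hx0, ← ENNReal.ofReal_mul (by positivity)]
    congr 1
    rw [hρdef, Real.div_rpow hx0.le (by norm_num), Real.rpow_neg (by norm_num)]
    field_simp
  calc _ ≤ _ := h1
    _ ≤ ENNReal.ofReal (ρ ^ p) + ENNReal.ofReal (C * ρ ^ p) * Ip d p := by gcongr
    _ = (1 + ENNReal.ofReal C * Ip d p) * ENNReal.ofReal (ρ ^ p) := by
        rw [ENNReal.ofReal_mul hC.le]; ring
    _ = _ := by rw [h4]; ring

lemma Rtendsto {d : ℕ} (hd : 3 ≤ d) {p : ℝ} (hp1 : 2 - (d : ℝ) ≤ p) (hp2 : p < 0)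
    {η : Measure (Eu d)} [IsProbabilityMeasure η]
    {C : ℝ} (h : Good d η C) {ε : ℕ → ℝ} (hε : ∀ k, 0 < ε k) (hε0 : Tendsto ε atTop (𝓝 0))
    {x : Eu d} (hx : x ≠ 0) :
    Tendsto (fun k => ∫⁻ z, (‖x - ε k • z‖₊ : ℝ≥0∞) ^ p ∂η) atTop (𝓝 ((‖x‖₊ : ℝ≥0∞) ^ p)) := by
  have hx0 : 0 < ‖x‖ := norm_pos_iff.2 hx
  have hC := h.1
  set ρ := ‖x‖ / 2 with hρdef
  have hρ : 0 < ρ := by positivity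
  have hT : ∀ k, MeasurableSet {z : Eu d | ‖x - ε k • z‖ < ρ} := fun k =>
    measurableSet_lt (by fun_prop) measurable_const
  have hnear : Tendsto (fun k => ∫⁻ z in {z : Eu d | ‖x - ε k • z‖ < ρ},
      (‖x - ε k • z‖₊ : ℝ≥0∞) ^ p ∂η) atTop (𝓝 0) := by
    have hlim : Tendsto (fun k => ENNReal.ofReal (C * ρ ^ p / ρ * ε k) * Ip d p) atTop (𝓝 0) := by
      have h1 : Tendsto (fun k => C * ρ ^ p / ρ * ε k) atTop (𝓝 (C * ρ ^ p / ρ * 0)) :=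
        hε0.const_mul _
      have h2 := ENNReal.tendsto_ofReal h1
      have h3 := ENNReal.Tendsto.mul_const (b := Ip d p) h2
        (Or.inr (lint_ball_rpow_lt_top hd hp1).ne)
      simpa using h3
    refine tendsto_of_tendsto_of_tendsto_of_le_of_le tendsto_const_nhds hlim
      (fun _ => zero_le) (fun k => ?_)
    have hr : 0 < ρ / ε k := div_pos hρ (hε k)
    refine (Rnear h (hε k) hρ hr.le x (near_far (hε k) x)).trans ?_
    refine mul_le_mul_left (ENNReal.ofReal_le_ofReal ?_) _
    set r := ρ / ε k with hrdef
    have h3 : r ^ (d + 1) ≤ (1 + r) ^ (d + 1) := by gcongr; linarith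
    have h4 : C * ρ ^ p / ρ * ε k = C * ρ ^ p / r := by
      have := hε k
      rw [hrdef]; field_simp
    rw [h4]
    calc C / (1 + r) ^ (d + 1) * (ρ ^ p * r ^ d) ≤ C / r ^ (d + 1) * (ρ ^ p * r ^ d) := by
          gcongr
      _ = _ := by rw [pow_succ]; field_simp
  have hfar : Tendsto (fun k => ∫⁻ z in {z : Eu d | ‖x - ε k • z‖ < ρ}ᶜ,
      (‖x - ε k • z‖₊ : ℝ≥0∞) ^ p ∂η) atTop (𝓝 ((‖x‖₊ : ℝ≥0∞) ^ p)) := by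
    have hrw : ∀ k, ∫⁻ z in {z : Eu d | ‖x - ε k • z‖ < ρ}ᶜ, (‖x - ε k • z‖₊ : ℝ≥0∞) ^ p ∂η
        = ∫⁻ z, ({z : Eu d | ‖x - ε k • z‖ < ρ}ᶜ).indicator
          (fun z => (‖x - ε k • z‖₊ : ℝ≥0∞) ^ p) z ∂η := fun k =>
      (lintegral_indicator (hT k).compl _).symm
    simp_rw [hrw]
    have hcst : (‖x‖₊ : ℝ≥0∞) ^ p = ∫⁻ _ : Eu d, (‖x‖₊ : ℝ≥0∞) ^ p ∂η := by simp
    rw [hcst]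
    apply tendsto_lintegral_of_dominated_convergence (fun _ => ENNReal.ofReal (ρ ^ p))
    · intro k
      exact Measurable.indicator (by fun_prop) (hT k).compl
    · intro k
      apply Eventually.of_forall
      intro z
      by_cases hz : z ∈ {z : Eu d | ‖x - ε k • z‖ < ρ}ᶜ
      · simp only [Set.indicator_of_mem hz]
        have hz' : ¬ ‖x - ε k • z‖ < ρ := hz
        exact far_le hp2 hρ (not_lt.1 hz')
      · simp only [Set.indicator_of_notMem hz]
        exact zero_le
    · simp
    · apply Eventually.of_forall
      intro z
      have hz : Tendsto (fun k => x - ε k • z) atTop (𝓝 x) := by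
        have : Tendsto (fun k => x - ε k • z) atTop (𝓝 (x - (0 : ℝ) • z)) :=
          tendsto_const_nhds.sub (hε0.smul_const z)
        simpa using this
      have h1 : Tendsto (fun k => (‖x - ε k • z‖₊ : ℝ≥0∞) ^ p) atTop (𝓝 ((‖x‖₊ : ℝ≥0∞) ^ p)) :=
        ((ENNReal.continuous_rpow_const.comp
          (ENNReal.continuous_coe.comp continuous_nnnorm)).tendsto x).comp hz
      refine h1.congr' ?_
      have h2 : ∀ᶠ k in atTop, ρ < ‖x - ε k • z‖ :=
        hz.norm.eventually_const_lt (by rw [hρdef]; linarith)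
      filter_upwards [h2] with k hk
      rw [Set.indicator_of_mem]
      change ¬ ‖x - ε k • z‖ < ρ
      exact not_lt.2 hk.le
  have := hnear.add hfar
  rw [zero_add] at this
  refine this.congr (fun k => ?_)
  exact lintegral_add_compl _ (hT k)

/-- moment constant -/
def Mc (d : ℕ) (η : Measure (Eu d)) : ℝ≥0∞ := 1 + ∫⁻ z, (‖z‖₊ : ℝ≥0∞) ^ 2 ∂η

lemma smul_q_le {d : ℕ} {q : ℝ} (hq1 : 0 < q) {ε : ℝ} (hε : 0 < ε)
    (hε1 : ε ≤ 1) (z : Eu d) : (‖ε • z‖₊ : ℝ≥0∞) ^ q ≤ (‖z‖₊ : ℝ≥0∞) ^ q := by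
  apply ENNReal.rpow_le_rpow _ hq1.le
  have : ‖ε • z‖ ≤ ‖z‖ := by
    rw [norm_smul, Real.norm_of_nonneg hε.le]
    exact mul_le_of_le_one_left (norm_nonneg _) hε1
  exact_mod_cast this

lemma moment_q {d : ℕ} {q : ℝ} (hq1 : 0 < q) (hq2 : q ≤ 2) (η : Measure (Eu d))
    [IsProbabilityMeasure η] : ∫⁻ z, (‖z‖₊ : ℝ≥0∞) ^ q ∂η ≤ Mc d η := by
  calc _ ≤ ∫⁻ z, (1 + (‖z‖₊ : ℝ≥0∞) ^ 2) ∂η := lintegral_mono fun z => rpow_le_one_add_sq hq1 hq2 _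
    _ = _ := by rw [lintegral_add_left (by fun_prop)]; simp [Mc]

lemma Apt {d : ℕ} {q : ℝ} (hq1 : 0 < q) (hq2 : q ≤ 2) {ε : ℝ} (hε : 0 < ε) (hε1 : ε ≤ 1)
    (x z : Eu d) :
    (‖x - ε • z‖₊ : ℝ≥0∞) ^ q ≤ 4 * ((‖x‖₊ : ℝ≥0∞) ^ q + (‖z‖₊ : ℝ≥0∞) ^ q) := by
  have h1 : (‖x - ε • z‖₊ : ℝ≥0∞) ≤ ‖x‖₊ + ‖ε • z‖₊ := by exact_mod_cast nnnorm_sub_le _ _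
  calc _ ≤ ((‖x‖₊ : ℝ≥0∞) + ‖ε • z‖₊) ^ q := ENNReal.rpow_le_rpow h1 hq1.le
    _ ≤ 4 * ((‖x‖₊ : ℝ≥0∞) ^ q + (‖ε • z‖₊ : ℝ≥0∞) ^ q) := pow_add_le_four hq1 hq2 _ _
    _ ≤ _ := by gcongr 4 * (_ + ?_); exact smul_q_le hq1 hε hε1 z

lemma Adom {d : ℕ} {q : ℝ} (hq1 : 0 < q) (hq2 : q ≤ 2) (η : Measure (Eu d))
    [IsProbabilityMeasure η] {ε : ℝ} (hε : 0 < ε) (hε1 : ε ≤ 1) (x : Eu d) :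
    ∫⁻ z, (‖x - ε • z‖₊ : ℝ≥0∞) ^ q ∂η ≤ 4 * ((‖x‖₊ : ℝ≥0∞) ^ q + Mc d η) := by
  calc _ ≤ ∫⁻ z, 4 * ((‖x‖₊ : ℝ≥0∞) ^ q + (‖z‖₊ : ℝ≥0∞) ^ q) ∂η :=
        lintegral_mono fun z => Apt hq1 hq2 hε hε1 x z
    _ = 4 * ((‖x‖₊ : ℝ≥0∞) ^ q + ∫⁻ z, (‖z‖₊ : ℝ≥0∞) ^ q ∂η) := by
        rw [lintegral_const_mul _ (by fun_prop), lintegral_add_left (by fun_prop)]; simp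
    _ ≤ _ := by gcongr; exact moment_q hq1 hq2 η

lemma Arev {d : ℕ} {q : ℝ} (hq1 : 0 < q) (hq2 : q ≤ 2) (η : Measure (Eu d))
    [IsProbabilityMeasure η] {ε : ℝ} (hε : 0 < ε) (hε1 : ε ≤ 1) (x : Eu d) :
    (‖x‖₊ : ℝ≥0∞) ^ q ≤ 4 * (∫⁻ z, (‖x - ε • z‖₊ : ℝ≥0∞) ^ q ∂η + Mc d η) := by
  calc (‖x‖₊ : ℝ≥0∞) ^ q = ∫⁻ _ : Eu d, (‖x‖₊ : ℝ≥0∞) ^ q ∂η := by simp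
    _ ≤ ∫⁻ z, 4 * ((‖x - ε • z‖₊ : ℝ≥0∞) ^ q + (‖z‖₊ : ℝ≥0∞) ^ q) ∂η := by
        apply lintegral_mono; intro z
        have h1 : (‖x‖₊ : ℝ≥0∞) ≤ ‖x - ε • z‖₊ + ‖ε • z‖₊ := by
          have := nnnorm_add_le (x - ε • z) (ε • z)
          rw [sub_add_cancel] at this
          exact_mod_cast this
        calc _ ≤ ((‖x - ε • z‖₊ : ℝ≥0∞) + ‖ε • z‖₊) ^ q := ENNReal.rpow_le_rpow h1 hq1.le
          _ ≤ 4 * ((‖x - ε • z‖₊ : ℝ≥0∞) ^ q + (‖ε • z‖₊ : ℝ≥0∞) ^ q) :=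
            pow_add_le_four hq1 hq2 _ _
          _ ≤ 4 * ((‖x - ε • z‖₊ : ℝ≥0∞) ^ q + (‖z‖₊ : ℝ≥0∞) ^ q) := by
            gcongr 4 * (_ + ?_); exact smul_q_le hq1 hε hε1 z
    _ = 4 * (∫⁻ z, (‖x - ε • z‖₊ : ℝ≥0∞) ^ q ∂η + ∫⁻ z, (‖z‖₊ : ℝ≥0∞) ^ q ∂η) := by
        rw [lintegral_const_mul _ (by fun_prop), lintegral_add_left (by fun_prop)]
    _ ≤ _ := by gcongr; exact moment_q hq1 hq2 η

lemma Atendsto {d : ℕ} {q : ℝ} (hq1 : 0 < q) (hq2 : q ≤ 2)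
    {η : Measure (Eu d)} [IsProbabilityMeasure η] (hη : Mc d η ≠ ⊤)
    {ε : ℕ → ℝ} (hε : ∀ k, 0 < ε k) (hε1 : ∀ k, ε k ≤ 1) (hε0 : Tendsto ε atTop (𝓝 0))
    (x : Eu d) :
    Tendsto (fun k => ∫⁻ z, (‖x - ε k • z‖₊ : ℝ≥0∞) ^ q ∂η) atTop (𝓝 ((‖x‖₊ : ℝ≥0∞) ^ q)) := by
  have hcst : (‖x‖₊ : ℝ≥0∞) ^ q = ∫⁻ _ : Eu d, (‖x‖₊ : ℝ≥0∞) ^ q ∂η := by simp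
  rw [hcst]
  apply tendsto_lintegral_of_dominated_convergence
    (fun z => 4 * ((‖x‖₊ : ℝ≥0∞) ^ q + (‖z‖₊ : ℝ≥0∞) ^ q))
  · intro k; fun_prop
  · intro k
    exact Eventually.of_forall fun z => Apt hq1 hq2 (hε k) (hε1 k) x z
  · rw [lintegral_const_mul _ (by fun_prop), lintegral_add_left (by fun_prop)]
    refine ENNReal.mul_ne_top (by norm_num) (ENNReal.add_ne_top.2 ⟨?_, ?_⟩)
    · simp [hq1.le]
    · exact ((moment_q hq1 hq2 η).trans_lt hη.lt_top).ne
  · apply Eventually.of_forall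
    intro z
    have hz : Tendsto (fun k => x - ε k • z) atTop (𝓝 x) := by
      have : Tendsto (fun k => x - ε k • z) atTop (𝓝 (x - (0 : ℝ) • z)) :=
        tendsto_const_nhds.sub (hε0.smul_const z)
      simpa using this
    exact ((ENNReal.continuous_rpow_const.comp
          (ENNReal.continuous_coe.comp continuous_nnnorm)).tendsto x).comp hz


/-- regularized kernel w.r.t. a probability measure `η` -/
def Kt (d : ℕ) (p q : ℝ) (η : Measure (Eu d)) (ε : ℝ) (x : Eu d) : ℝ≥0∞ :=
  ∫⁻ z, KE d p q (x - ε • z) ∂η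

lemma Kt_eq {d : ℕ} {p q : ℝ} (η : Measure (Eu d)) (ε : ℝ) (x : Eu d) :
    Kt d p q η ε x = (∫⁻ z, (‖x - ε • z‖₊ : ℝ≥0∞) ^ q ∂η) / ENNReal.ofReal q
      + (∫⁻ z, (‖x - ε • z‖₊ : ℝ≥0∞) ^ p ∂η) / ENNReal.ofReal (-p) := by
  unfold Kt KE
  rw [lintegral_add_left (by fun_prop)]
  simp_rw [div_eq_mul_inv]
  rw [lintegral_mul_const _ (by fun_prop), lintegral_mul_const _ (by fun_prop)]

lemma measurable_Kt {d : ℕ} {p q : ℝ} (η : Measure (Eu d)) [SFinite η] (ε : ℝ) :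
    Measurable (Kt d p q η ε) := by
  have hm : Measurable (fun xz : Eu d × Eu d => KE d p q (xz.1 - ε • xz.2)) :=
    measurable_KE.comp (by fun_prop)
  exact hm.lintegral_prod_right'

lemma KE_zero {d : ℕ} {p q : ℝ} (hp2 : p < 0) : KE d p q 0 = ⊤ := by
  unfold KE
  rw [nnnorm_zero, ENNReal.coe_zero, ENNReal.zero_rpow_of_neg hp2,
    ENNReal.top_div_of_ne_top ENNReal.ofReal_ne_top]
  simp

lemma Kt_le {d : ℕ} (hd : 3 ≤ d) {p q : ℝ} (hp1 : 2 - (d : ℝ) ≤ p) (hp2 : p < 0)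
    (hq1 : 0 < q) (hq2 : q ≤ 2) {η : Measure (Eu d)} [IsProbabilityMeasure η]
    {C : ℝ} (h : Good d η C) (hη : Mc d η ≠ ⊤) :
    ∃ D : ℝ≥0∞, D ≠ ⊤ ∧ ∀ ε : ℝ, 0 < ε → ε ≤ 1 → ∀ x, Kt d p q η ε x ≤ D * (KE d p q x + 1) := by
  have hI : Ip d p ≠ ⊤ := (lint_ball_rpow_lt_top hd hp1).ne
  have hq : ENNReal.ofReal q ≠ 0 := by simpa using hq1
  set c2 := (1 + ENNReal.ofReal C * Ip d p) * ENNReal.ofReal (2 ^ (-p)) with hc2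
  have hc2t : c2 ≠ ⊤ := ENNReal.mul_ne_top
    (ENNReal.add_ne_top.2 ⟨by simp, ENNReal.mul_ne_top ENNReal.ofReal_ne_top hI⟩)
    ENNReal.ofReal_ne_top
  set c3 := 4 * Mc d η / ENNReal.ofReal q with hc3
  have hc3t : c3 ≠ ⊤ := ENNReal.div_ne_top (ENNReal.mul_ne_top (by norm_num) hη) hq
  refine ⟨4 + c2 + c3, by simp [hc2t, hc3t], fun ε hε hε1 x => ?_⟩
  by_cases hx : x = 0
  · rw [hx, KE_zero hp2, top_add, ENNReal.mul_top (by simp)]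
    exact le_top
  · rw [Kt_eq]
    unfold KE
    set X := (‖x‖₊ : ℝ≥0∞) ^ q / ENNReal.ofReal q with hX
    set Y := (‖x‖₊ : ℝ≥0∞) ^ p / ENNReal.ofReal (-p) with hY
    have h1 : (∫⁻ z, (‖x - ε • z‖₊ : ℝ≥0∞) ^ q ∂η) / ENNReal.ofReal q ≤ 4 * X + c3 := by
      calc _ ≤ 4 * ((‖x‖₊ : ℝ≥0∞) ^ q + Mc d η) / ENNReal.ofReal q := by
            gcongr; exact Adom hq1 hq2 η hε hε1 x
        _ = _ := by rw [mul_add, ENNReal.add_div, hX, mul_div_assoc]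
    have h2 : (∫⁻ z, (‖x - ε • z‖₊ : ℝ≥0∞) ^ p ∂η) / ENNReal.ofReal (-p) ≤ c2 * Y := by
      calc _ ≤ c2 * (‖x‖₊ : ℝ≥0∞) ^ p / ENNReal.ofReal (-p) := by
            gcongr; exact Rdom hp2 h hε hx
        _ = _ := by rw [hY, mul_div_assoc]
    calc _ ≤ 4 * X + c3 + c2 * Y := add_le_add h1 h2
      _ ≤ 4 * X + c3 + c2 * Y + (4 + c2 + c3 * X + c3 * Y + c2 * X + 4 * Y) := le_self_add
      _ = _ := by ring

lemma Kt_fin {d : ℕ} (hd : 3 ≤ d) {p q : ℝ} (hp1 : 2 - (d : ℝ) ≤ p) (hp2 : p < 0)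
    (hq1 : 0 < q) (hq2 : q ≤ 2) {η : Measure (Eu d)} [IsProbabilityMeasure η]
    {C : ℝ} (h : Good d η C) (hη : Mc d η ≠ ⊤) {ε : ℝ} (hε : 0 < ε) (hε1 : ε ≤ 1) :
    ∃ D : ℝ≥0∞, D ≠ ⊤ ∧ ∀ x, Kt d p q η ε x ≤ D * ((‖x‖₊ : ℝ≥0∞) ^ q + 1) := by
  have hI : Ip d p ≠ ⊤ := (lint_ball_rpow_lt_top hd hp1).ne
  have hq : ENNReal.ofReal q ≠ 0 := by simpa using hq1
  have hp : ENNReal.ofReal (-p) ≠ 0 := by simpa using hp2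
  set c2 := (1 + ENNReal.ofReal (C * (1 / ε) ^ d) * Ip d p) / ENNReal.ofReal (-p) with hc2
  have hc2t : c2 ≠ ⊤ := ENNReal.div_ne_top
    (ENNReal.add_ne_top.2 ⟨by simp, ENNReal.mul_ne_top ENNReal.ofReal_ne_top hI⟩) hp
  set c3 := 4 / ENNReal.ofReal q with hc3
  have hc3t : c3 ≠ ⊤ := ENNReal.div_ne_top (by norm_num) hq
  refine ⟨c2 + c3 + c3 * Mc d η, by simp [hc2t, hc3t, ENNReal.mul_ne_top, hη], fun x => ?_⟩
  rw [Kt_eq]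
  have h1 : (∫⁻ z, (‖x - ε • z‖₊ : ℝ≥0∞) ^ q ∂η) / ENNReal.ofReal q
      ≤ c3 * ((‖x‖₊ : ℝ≥0∞) ^ q + Mc d η) := by
    calc _ ≤ 4 * ((‖x‖₊ : ℝ≥0∞) ^ q + Mc d η) / ENNReal.ofReal q := by
          gcongr; exact Adom hq1 hq2 η hε hε1 x
      _ = _ := by rw [hc3, div_eq_mul_inv, div_eq_mul_inv]; ring
  have h2 : (∫⁻ z, (‖x - ε • z‖₊ : ℝ≥0∞) ^ p ∂η) / ENNReal.ofReal (-p) ≤ c2 := by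
    rw [hc2]; gcongr; exact Rfin hp2 h hε x
  set X := (‖x‖₊ : ℝ≥0∞) ^ q
  calc _ ≤ c3 * (X + Mc d η) + c2 := add_le_add h1 h2
    _ ≤ c3 * (X + Mc d η) + c2 + (c2 * X + c3 + c3 * Mc d η * X) := le_self_add
    _ = _ := by ring

lemma Kt_tendsto {d : ℕ} (hd : 3 ≤ d) {p q : ℝ} (hp1 : 2 - (d : ℝ) ≤ p) (hp2 : p < 0)
    (hq1 : 0 < q) (hq2 : q ≤ 2) {η : Measure (Eu d)} [IsProbabilityMeasure η]
    {C : ℝ} (h : Good d η C) (hη : Mc d η ≠ ⊤)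
    {ε : ℕ → ℝ} (hε : ∀ k, 0 < ε k) (hε1 : ∀ k, ε k ≤ 1) (hε0 : Tendsto ε atTop (𝓝 0))
    {x : Eu d} (hx : x ≠ 0) :
    Tendsto (fun k => Kt d p q η (ε k) x) atTop (𝓝 (KE d p q x)) := by
  have hq : ENNReal.ofReal q ≠ 0 := by simpa using hq1
  have hp : ENNReal.ofReal (-p) ≠ 0 := by simpa using hp2
  simp_rw [Kt_eq]
  unfold KE
  exact (ENNReal.Tendsto.div_const (Atendsto hq1 hq2 hη hε hε1 hε0 x) (Or.inr hq)).add
    (ENNReal.Tendsto.div_const (Rtendsto hd hp1 hp2 h hε hε0 hx) (Or.inr hp))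

lemma energy_prod {d : ℕ} {K : Eu d → ℝ≥0∞} (hK : Measurable K) (σ : Measure (Eu d)) [SFinite σ] :
    energyE d K σ = ∫⁻ z, K (z.1 - z.2) ∂(σ.prod σ) := by
  rw [lintegral_prod _ (by fun_prop)]; rfl

lemma recovery {d : ℕ} (hd : 3 ≤ d) {p q : ℝ} (hp1 : 2 - (d : ℝ) ≤ p) (hp2 : p < 0)
    (hq1 : 0 < q) (hq2 : q ≤ 2) {η : Measure (Eu d)} [IsProbabilityMeasure η]
    {C : ℝ} (h : Good d η C) (hη : Mc d η ≠ ⊤)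
    {ε : ℕ → ℝ} (hε : ∀ k, 0 < ε k) (hε1 : ∀ k, ε k ≤ 1) (hε0 : Tendsto ε atTop (𝓝 0))
    (σ : Measure (Eu d)) [IsProbabilityMeasure σ] (hσ : energyE d (KE d p q) σ ≠ ⊤) :
    Tendsto (fun k => energyE d (Kt d p q η (ε k)) σ) atTop (𝓝 (energyE d (KE d p q) σ)) := by
  obtain ⟨D, hD, hle⟩ := Kt_le hd hp1 hp2 hq1 hq2 h hη
  simp_rw [energy_prod (measurable_Kt η _)]
  rw [energy_prod measurable_KE] at hσ ⊢
  have hKm : Measurable (fun z : Eu d × Eu d => KE d p q (z.1 - z.2)) :=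
    measurable_KE.comp (by fun_prop)
  apply tendsto_lintegral_of_dominated_convergence
    (fun z : Eu d × Eu d => D * (KE d p q (z.1 - z.2) + 1))
  · intro k
    exact (measurable_Kt η _).comp (by fun_prop)
  · intro k
    exact Eventually.of_forall fun z => hle (ε k) (hε k) (hε1 k) _
  · rw [lintegral_const_mul _ (by fun_prop), lintegral_add_left hKm]
    refine ENNReal.mul_ne_top hD (ENNReal.add_ne_top.2 ⟨hσ, by simp⟩)
  · filter_upwards [ae_lt_top hKm hσ] with z hz
    apply Kt_tendsto hd hp1 hp2 hq1 hq2 h hη hε hε1 hε0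
    intro h0
    rw [h0, KE_zero hp2] at hz
    exact lt_irrefl _ hz

lemma energy_bound {d : ℕ} (hd : 3 ≤ d) {p q : ℝ} (hp1 : 2 - (d : ℝ) ≤ p) (hp2 : p < 0)
    (hq1 : 0 < q) (hq2 : q ≤ 2) {η : Measure (Eu d)} [IsProbabilityMeasure η]
    {C : ℝ} (h : Good d η C) (hη : Mc d η ≠ ⊤)
    (σ : Measure (Eu d)) [IsProbabilityMeasure σ] (hσ : energyE d (KE d p q) σ ≠ ⊤) :
    ∃ B : ℝ≥0∞, B ≠ ⊤ ∧ ∀ ε : ℝ, 0 < ε → ε ≤ 1 → energyE d (Kt d p q η ε) σ ≤ B := by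
  obtain ⟨D, hD, hle⟩ := Kt_le hd hp1 hp2 hq1 hq2 h hη
  rw [energy_prod measurable_KE] at hσ
  have hKm : Measurable (fun z : Eu d × Eu d => KE d p q (z.1 - z.2)) :=
    measurable_KE.comp (by fun_prop)
  refine ⟨∫⁻ z, D * (KE d p q (z.1 - z.2) + 1) ∂(σ.prod σ), ?_, fun ε hε hε1 => ?_⟩
  · rw [lintegral_const_mul _ (by fun_prop), lintegral_add_left hKm]
    refine ENNReal.mul_ne_top hD (ENNReal.add_ne_top.2 ⟨hσ, by simp⟩)
  · rw [energy_prod (measurable_Kt η _)]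
    exact lintegral_mono fun z => hle ε hε hε1 _

/-- a good measure has finite energy -/
lemma good_energy {d : ℕ} (hd : 3 ≤ d) {p q : ℝ} (hp1 : 2 - (d : ℝ) ≤ p) (hp2 : p < 0)
    (hq1 : 0 < q) (hq2 : q ≤ 2) {η : Measure (Eu d)} [IsProbabilityMeasure η]
    {C : ℝ} (h : Good d η C) (hη : Mc d η ≠ ⊤) : energyE d (KE d p q) η ≠ ⊤ := by
  obtain ⟨D, hD, hle⟩ := Kt_fin hd hp1 hp2 hq1 hq2 h hη one_pos le_rfl
  apply ne_of_lt
  calc energyE d (KE d p q) η = ∫⁻ x, Kt d p q η 1 x ∂η := by simp [energyE, Kt]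
    _ ≤ ∫⁻ x, D * ((‖x‖₊ : ℝ≥0∞) ^ q + 1) ∂η := lintegral_mono hle
    _ = D * (∫⁻ x, (‖x‖₊ : ℝ≥0∞) ^ q ∂η + 1) := by
        rw [lintegral_const_mul _ (by fun_prop), lintegral_add_left (by fun_prop)]; simp
    _ < ⊤ := ENNReal.mul_lt_top hD.lt_top (ENNReal.add_lt_top.2
        ⟨(moment_q hq1 hq2 η).trans_lt hη.lt_top, by simp⟩)

lemma scaled_lint {d : ℕ} {φ : Eu d → ℝ} {ε : ℝ} (hε : 0 < ε)
    (g : Eu d → ℝ≥0∞) :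
    ∫⁻ z, ENNReal.ofReal (scaled d φ ε z) * g z = ∫⁻ z, ENNReal.ofReal (φ z) * g (ε • z) := by
  have h1 := lintegral_affine (fun z => ENNReal.ofReal (scaled d φ ε z) * g z)
    (neg_ne_zero.2 hε.ne') (0 : Eu d)
  have h2 : ∀ z : Eu d, ENNReal.ofReal (scaled d φ ε (0 - (-ε) • z)) * g (0 - (-ε) • z)
      = ENNReal.ofReal ((ε ^ d)⁻¹) * (ENNReal.ofReal (φ z) * g (ε • z)) := by
    intro z
    have e : (0 : Eu d) - (-ε) • z = ε • z := by simp
    rw [e, scaled, smul_smul, inv_mul_cancel₀ hε.ne', one_smul,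
      ENNReal.ofReal_mul (by positivity), mul_assoc]
  simp_rw [h2] at h1
  rw [lintegral_const_mul' _ _ ENNReal.ofReal_ne_top] at h1
  have h3 : |((-ε) ^ d)⁻¹| = (ε ^ d)⁻¹ := by
    rw [abs_inv, abs_pow, abs_neg, abs_of_pos hε]
  rw [h3] at h1
  have h4 : ENNReal.ofReal ((ε ^ d)⁻¹) ≠ 0 := by
    have : 0 < (ε ^ d)⁻¹ := by positivity
    simpa using this
  exact ((ENNReal.mul_right_inj h4 ENNReal.ofReal_ne_top).1 h1).symm

lemma ofReal_Kfun {d : ℕ} {p q : ℝ} (hp2 : p < 0) (hq1 : 0 < q) {x : Eu d} (hx : x ≠ 0) :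
    ENNReal.ofReal (Kfun d p q x) = KE d p q x := by
  have hx0 := norm_pos_iff.2 hx
  unfold Kfun KE
  rw [coe_nnnorm_eq, ENNReal.ofReal_rpow_of_pos hx0, ENNReal.ofReal_rpow_of_pos hx0,
    ← ENNReal.ofReal_div_of_pos hq1, ← ENNReal.ofReal_div_of_pos (by linarith),
    ← ENNReal.ofReal_add (by positivity) (div_nonneg (by positivity) (by linarith))]
  congr 1
  rw [div_neg]; ring

lemma Kfun_nonneg {d : ℕ} {p q : ℝ} (hp2 : p < 0) (hq1 : 0 < q) (x : Eu d) :
    0 ≤ Kfun d p q x := by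
  unfold Kfun
  have h1 : 0 ≤ ‖x‖ ^ q / q := by positivity
  have h2 : ‖x‖ ^ p / p ≤ 0 := div_nonpos_of_nonneg_of_nonpos (by positivity) hp2.le
  linarith

lemma Kreg_eq {d : ℕ} (hd : 3 ≤ d) {p q : ℝ} (hp1 : 2 - (d : ℝ) ≤ p) (hp2 : p < 0)
    (hq1 : 0 < q) (hq2 : q ≤ 2) {φ : Eu d → ℝ} (hφ : IsMollifier d φ)
    {ε : ℝ} (hε : 0 < ε) (hε1 : ε ≤ 1) (x : Eu d) :
    ENNReal.ofReal (Kreg d p q φ ε x) = Kt d p q (m2 d φ) ε x := by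
  have := mm_prob hφ
  have := m2_prob hφ
  obtain ⟨C, hC⟩ := m2_good hd hφ
  have hη : Mc d (m2 d φ) ≠ ⊤ := by
    have := m2_moment hd hφ
    simp [Mc, this.ne]
  have hφm := moll_measurable hφ
  have hsm : Measurable (scaled d φ ε) := by unfold scaled; fun_prop
  have hKm : Measurable (Kfun d p q) := by unfold Kfun; fun_prop
  have hsn : ∀ z, 0 ≤ scaled d φ ε z := fun z => by
    have := hφ.2.2.1 (ε⁻¹ • z)
    unfold scaled; positivity
  set F : Eu d × Eu d → ℝ := fun yz =>
    scaled d φ ε yz.1 * Kfun d p q (x - yz.1 - yz.2) * scaled d φ ε yz.2 with hF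
  have hFm : Measurable F := by
    have h1 : Measurable (fun yz : Eu d × Eu d => Kfun d p q (x - yz.1 - yz.2)) :=
      hKm.comp (by fun_prop)
    exact ((hsm.comp measurable_fst).mul h1).mul (hsm.comp measurable_snd)
  have hFn : ∀ yz, 0 ≤ F yz := fun yz =>
    mul_nonneg (mul_nonneg (hsn _) (Kfun_nonneg hp2 hq1 _)) (hsn _)
  have hne : Nonempty (Fin d) := ⟨⟨0, by omega⟩⟩
  have hnt : Nontrivial (Eu d) := inferInstance
  have hKEm : Measurable (KE d p q) := measurable_KE
  have hlint : ∫⁻ yz, ENNReal.ofReal (F yz) ∂(volume.prod volume) = Kt d p q (m2 d φ) ε x := by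
    rw [lintegral_prod _ (by fun_prop)]
    have e1 : ∀ y, ∫⁻ z, ENNReal.ofReal (F (y, z)) = ENNReal.ofReal (scaled d φ ε y) *
        ∫⁻ z, ENNReal.ofReal (φ z) * KE d p q (x - y - ε • z) := by
      intro y
      rw [← scaled_lint hε (fun z => KE d p q (x - y - z)),
        ← lintegral_const_mul' _ _ ENNReal.ofReal_ne_top]
      apply lintegral_congr_ae
      filter_upwards [Measure.ae_ne volume (x - y)] with z hz
      have hz' : x - y - z ≠ 0 := sub_ne_zero.2 (Ne.symm hz)
      simp only [hF]
      rw [ENNReal.ofReal_mul (mul_nonneg (hsn _) (Kfun_nonneg hp2 hq1 _)),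
        ENNReal.ofReal_mul (hsn _), ofReal_Kfun hp2 hq1 hz']
      ring
    simp_rw [e1]
    rw [scaled_lint hε (fun y => ∫⁻ z, ENNReal.ofReal (φ z) * KE d p q (x - y - ε • z))]
    unfold Kt m2
    rw [Measure.lintegral_conv (by fun_prop)]
    have e2 : ∀ y, ∫⁻ z, ENNReal.ofReal (φ z) * KE d p q (x - ε • y - ε • z)
        = ∫⁻ z, KE d p q (x - ε • (y + z)) ∂(mm d φ) := by
      intro y
      rw [mm, lintegral_withDensity_eq_lintegral_mul _ (by fun_prop) (by fun_prop)]
      simp only [Pi.mul_apply, smul_add, sub_sub]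
    simp_rw [e2]
    have hm3 : Measurable (fun y => ∫⁻ z, KE d p q (x - ε • (y + z)) ∂(mm d φ)) := by
      have : Measurable (fun yz : Eu d × Eu d => KE d p q (x - ε • (yz.1 + yz.2))) :=
        hKEm.comp (by fun_prop)
      exact this.lintegral_prod_right'
    have hw : ∀ G : Eu d → ℝ≥0∞, Measurable G →
        ∫⁻ y, G y ∂(mm d φ) = ∫⁻ y, ENNReal.ofReal (φ y) * G y := by
      intro G hG
      rw [mm, lintegral_withDensity_eq_lintegral_mul _ (by fun_prop) hG]; rfl
    exact (hw _ hm3).symm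
  have hfin : Kt d p q (m2 d φ) ε x ≠ ⊤ := by
    obtain ⟨D, hD, hle⟩ := Kt_fin hd hp1 hp2 hq1 hq2 hC hη hε hε1
    refine ((hle x).trans_lt (ENNReal.mul_lt_top hD.lt_top ?_)).ne
    exact ENNReal.add_lt_top.2 ⟨ENNReal.rpow_lt_top_of_nonneg hq1.le ENNReal.coe_ne_top, by simp⟩
  have hint : Integrable F (volume.prod volume) := by
    refine ⟨hFm.aestronglyMeasurable, ?_⟩
    rw [hasFiniteIntegral_iff_ofReal (Eventually.of_forall hFn), hlint]
    exact hfin.lt_top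
  have e : Kreg d p q φ ε x = ∫ yz, F yz ∂(volume.prod volume) := by
    rw [integral_prod _ hint]; rfl
  rw [e, ofReal_integral_eq_lintegral_ofReal hint (Eventually.of_forall hFn), hlint]


lemma energy_comb {d : ℕ} {κ : Eu d → ℝ≥0∞} (hκ : Measurable κ) (μ : Measure (Eu d))
    [IsProbabilityMeasure μ] (x : Eu d) (a b : ℝ≥0∞) :
    energyE d κ (a • μ + b • Measure.dirac x) =
      a * (a * energyE d κ μ + b * ∫⁻ y, κ (y - x) ∂μ) +
        b * (a * ∫⁻ y, κ (x - y) ∂μ + b * κ 0) := by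
  have h1 : ∀ y, ∫⁻ z, κ (y - z) ∂(a • μ + b • Measure.dirac x) =
      a * ∫⁻ z, κ (y - z) ∂μ + b * κ (y - x) := by
    intro y
    rw [lintegral_add_measure, lintegral_smul_measure, lintegral_smul_measure,
      lintegral_dirac' _ (by fun_prop)]
    rfl
  have hm : Measurable (fun y => ∫⁻ z, κ (y - z) ∂μ) := by
    have : Measurable (fun yz : Eu d × Eu d => κ (yz.1 - yz.2)) := hκ.comp (by fun_prop)
    exact this.lintegral_prod_right'
  unfold energyE
  simp_rw [h1]
  rw [lintegral_add_measure, lintegral_smul_measure, lintegral_smul_measure,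
      lintegral_dirac' _ (by fun_prop), lintegral_add_left (by fun_prop),
      lintegral_const_mul _ hm, lintegral_const_mul _ (by fun_prop)]
  simp

lemma EL_ge {d : ℕ} {κ : Eu d → ℝ≥0∞} (hκ : Measurable κ) (hκ0 : κ 0 ≠ ⊤)
    (μ : Measure (Eu d)) (hμ : IsP2 d μ) (hE : energyE d κ μ ≠ ⊤)
    (hmin : ∀ ν, IsP2 d ν → energyE d κ μ ≤ energyE d κ ν) (x : Eu d) :
    2 * energyE d κ μ ≤ ∫⁻ y, κ (x - y) ∂μ + ∫⁻ y, κ (y - x) ∂μ := by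
  have := hμ.1
  by_cases hV : ∫⁻ y, κ (x - y) ∂μ = ⊤
  · simp [hV]
  by_cases hV' : ∫⁻ y, κ (y - x) ∂μ = ⊤
  · simp [hV']
  have key : ∀ t : ℝ, 0 < t → t < 1 → (energyE d κ μ).toReal ≤
      (1 - t) * ((1 - t) * (energyE d κ μ).toReal + t * (∫⁻ y, κ (y - x) ∂μ).toReal) +
        t * ((1 - t) * (∫⁻ y, κ (x - y) ∂μ).toReal + t * (κ 0).toReal) := by
    intro t ht ht1
    have hP : IsP2 d (ENNReal.ofReal (1 - t) • μ + ENNReal.ofReal t • Measure.dirac x) := by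
      constructor
      · constructor
        simp only [Measure.add_apply, Measure.smul_apply, measure_univ, smul_eq_mul, mul_one]
        rw [← ENNReal.ofReal_add (by linarith) ht.le]
        simp
      · rw [lintegral_add_measure, lintegral_smul_measure, lintegral_smul_measure,
          lintegral_dirac' _ (by fun_prop)]
        exact ENNReal.add_lt_top.2 ⟨ENNReal.mul_lt_top ENNReal.ofReal_lt_top hμ.2,
          ENNReal.mul_lt_top ENNReal.ofReal_lt_top (by finiteness)⟩
    have h := hmin _ hP
    rw [energy_comb hκ] at h
    have h2 := ENNReal.toReal_mono (by finiteness) h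
    rw [ENNReal.toReal_add (by finiteness) (by finiteness), ENNReal.toReal_mul, ENNReal.toReal_mul,
      ENNReal.toReal_add (by finiteness) (by finiteness),
      ENNReal.toReal_add (by finiteness) (by finiteness)] at h2
    simp only [ENNReal.toReal_mul] at h2
    rwa [ENNReal.toReal_ofReal ht.le, ENNReal.toReal_ofReal (by linarith)] at h2
  set e := (energyE d κ μ).toReal with he
  set u := (∫⁻ y, κ (x - y) ∂μ).toReal with hu
  set v := (∫⁻ y, κ (y - x) ∂μ).toReal with hv
  set k := (κ 0).toReal with hk
  have key2 : ∀ t : ℝ, 0 < t → t < 1 → 2 * e ≤ u + v + t * (e - u - v + k) := by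
    intro t ht ht1
    have := key t ht ht1
    have h3 : 0 ≤ t * (u + v + t * (e - u - v + k) - 2 * e) := by nlinarith
    have := nonneg_of_mul_nonneg_right h3 ht
    linarith
  have hlim : Tendsto (fun t : ℝ => u + v + t * (e - u - v + k)) (𝓝[>] 0) (𝓝 (u + v)) := by
    have : Continuous (fun t : ℝ => u + v + t * (e - u - v + k)) := by fun_prop
    have h := (this.tendsto 0).mono_left (nhdsWithin_le_nhds (s := Set.Ioi 0))
    simpa using h
  have hfin : 2 * e ≤ u + v := by
    refine ge_of_tendsto hlim ?_
    filter_upwards [Ioo_mem_nhdsGT (show (0 : ℝ) < 1 by norm_num)] with t ht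
    exact key2 t ht.1 ht.2
  rw [← ENNReal.ofReal_toReal hE, ← ENNReal.ofReal_toReal hV, ← ENNReal.ofReal_toReal hV',
    ← ENNReal.ofReal_add ENNReal.toReal_nonneg ENNReal.toReal_nonneg]
  have h2 : 2 * ENNReal.ofReal e = ENNReal.ofReal (2 * e) := by
    rw [ENNReal.ofReal_mul (by norm_num)]; simp
  rw [← he, h2]
  exact ENNReal.ofReal_le_ofReal hfin

lemma EL_le {d : ℕ} {κ : Eu d → ℝ≥0∞} (hκ : Measurable κ) (hκ0 : κ 0 ≠ ⊤)
    (μ : Measure (Eu d)) (hμ : IsP2 d μ) (hE : energyE d κ μ ≠ ⊤)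
    (hmin : ∀ ν, IsP2 d ν → energyE d κ μ ≤ energyE d κ ν) :
    ∀ᵐ x ∂μ, ∫⁻ y, κ (x - y) ∂μ ≤ 2 * energyE d κ μ := by
  have := hμ.1
  have hm0 : Measurable (fun yz : Eu d × Eu d => κ (yz.1 - yz.2)) := hκ.comp (by fun_prop)
  have hm : Measurable (fun y => ∫⁻ z, κ (y - z) ∂μ) := hm0.lintegral_prod_right'
  have hm1 : Measurable (fun yz : Eu d × Eu d => κ (yz.2 - yz.1)) := hκ.comp (by fun_prop)
  have hm' : Measurable (fun y => ∫⁻ z, κ (z - y) ∂μ) := hm1.lintegral_prod_right'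
  have h := ae_eq_of_ae_le_of_lintegral_le (μ := μ) (f := fun _ => 2 * energyE d κ μ)
    (g := fun x => ∫⁻ y, κ (x - y) ∂μ + ∫⁻ y, κ (y - x) ∂μ)
    (Eventually.of_forall fun x => EL_ge hκ hκ0 μ hμ hE hmin x)
    (by simp only [lintegral_const, measure_univ, mul_one]; finiteness)
    (hm.add hm').aemeasurable
    (by
      rw [lintegral_add_left hm, lintegral_lintegral_swap (f := fun x y => κ (y - x))
        hm1.aemeasurable]
      simp only [lintegral_const, measure_univ, mul_one]
      rw [two_mul]; rfl)
  filter_upwards [h] with x hx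
  rw [hx]
  exact le_self_add

lemma supp_bound {d : ℕ} (hd : 3 ≤ d) {p q : ℝ} (hp1 : 2 - (d : ℝ) ≤ p) (hp2 : p < 0)
    (hq1 : 0 < q) (hq2 : q ≤ 2) {η : Measure (Eu d)} [IsProbabilityMeasure η]
    {C : ℝ} (h : Good d η C) (hη : Mc d η ≠ ⊤) :
    ∃ R : ℝ, ∀ ε : ℝ, 0 < ε → ε ≤ 1 → ∀ μ : Measure (Eu d), IsP2 d μ →
      (∀ ν, IsP2 d ν → energyE d (Kt d p q η ε) μ ≤ energyE d (Kt d p q η ε) ν) →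
      ∃ x0 : Eu d, ∀ᵐ x ∂μ, ‖x - x0‖ ≤ R := by
  obtain ⟨B, hB, hBle⟩ := energy_bound hd hp1 hp2 hq1 hq2 h hη η
    (good_energy hd hp1 hp2 hq1 hq2 h hη)
  have hηP : IsP2 d η := ⟨inferInstance, by
    have : ∫⁻ z, (‖z‖₊ : ℝ≥0∞) ^ 2 ∂η ≤ Mc d η := le_add_self
    exact this.trans_lt hη.lt_top⟩
  set B' : ℝ≥0∞ := 4 * (ENNReal.ofReal q * (2 * B) + Mc d η) with hB'
  have hB't : B' ≠ ⊤ := by rw [hB']; finiteness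
  refine ⟨((4 * (B' + B')) ^ (1 / q)).toReal, ?_⟩
  intro ε hε hε1 μ hμ hmin
  have := hμ.1
  have hEB : energyE d (Kt d p q η ε) μ ≤ B := (hmin η hηP).trans (hBle ε hε hε1)
  obtain ⟨D, hD, hDle⟩ := Kt_fin hd hp1 hp2 hq1 hq2 h hη hε hε1
  have h0 : Kt d p q η ε 0 ≠ ⊤ := by
    refine ((hDle 0).trans_lt (ENNReal.mul_lt_top hD.lt_top ?_)).ne
    exact ENNReal.add_lt_top.2 ⟨ENNReal.rpow_lt_top_of_nonneg hq1.le ENNReal.coe_ne_top, by simp⟩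
  have hel := EL_le (measurable_Kt η ε) h0 μ hμ (ne_top_of_le_ne_top hB hEB) hmin
  have hq0 : ENNReal.ofReal q ≠ 0 := by simpa using hq1
  have hA : ∀ᵐ x ∂μ, ∫⁻ y, (‖x - y‖₊ : ℝ≥0∞) ^ q ∂μ ≤ B' := by
    filter_upwards [hel] with x hx
    calc ∫⁻ y, (‖x - y‖₊ : ℝ≥0∞) ^ q ∂μ
        ≤ ∫⁻ y, 4 * (ENNReal.ofReal q * Kt d p q η ε (x - y) + Mc d η) ∂μ := by
          apply lintegral_mono; intro y
          refine (Arev hq1 hq2 η hε hε1 (x - y)).trans ?_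
          refine mul_le_mul_right (add_le_add ?_ le_rfl) 4
          rw [Kt_eq, mul_add, ENNReal.mul_div_cancel hq0 ENNReal.ofReal_ne_top]
          exact le_self_add
      _ = 4 * (ENNReal.ofReal q * ∫⁻ y, Kt d p q η ε (x - y) ∂μ + Mc d η) := by
          have hm : Measurable (fun y => Kt d p q η ε (x - y)) :=
            (measurable_Kt η ε).comp (by fun_prop)
          rw [lintegral_const_mul _ (by fun_prop), lintegral_add_right _ measurable_const,
            lintegral_const_mul _ hm]
          simp
      _ ≤ B' := by
          rw [hB']
          refine mul_le_mul_right (add_le_add (mul_le_mul_right ?_ _) le_rfl) 4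
          exact hx.trans (mul_le_mul_right hEB 2)
  obtain ⟨x0, hx0⟩ := hA.exists
  refine ⟨x0, ?_⟩
  filter_upwards [hA] with x hx
  have h1 : (‖x - x0‖₊ : ℝ≥0∞) ^ q ≤ 4 * (B' + B') := by
    calc (‖x - x0‖₊ : ℝ≥0∞) ^ q = ∫⁻ _ : Eu d, (‖x - x0‖₊ : ℝ≥0∞) ^ q ∂μ := by simp
      _ ≤ ∫⁻ y, 4 * ((‖x - y‖₊ : ℝ≥0∞) ^ q + (‖x0 - y‖₊ : ℝ≥0∞) ^ q) ∂μ := by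
          apply lintegral_mono; intro y
          refine le_trans (ENNReal.rpow_le_rpow ?_ hq1.le) (pow_add_le_four hq1 hq2 _ _)
          have := nnnorm_sub_le (x - y) (x0 - y)
          rw [sub_sub_sub_cancel_right] at this
          exact_mod_cast this
      _ = 4 * (∫⁻ y, (‖x - y‖₊ : ℝ≥0∞) ^ q ∂μ + ∫⁻ y, (‖x0 - y‖₊ : ℝ≥0∞) ^ q ∂μ) := by
          rw [lintegral_const_mul _ (by fun_prop), lintegral_add_left (by fun_prop)]
      _ ≤ _ := mul_le_mul_right (add_le_add hx hx0) 4
  have h2 : (‖x - x0‖₊ : ℝ≥0∞) ≤ (4 * (B' + B')) ^ (1 / q) := by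
    rw [one_div]
    exact (ENNReal.le_rpow_inv_iff hq1).2 h1
  have h3 := ENNReal.toReal_mono
    (ENNReal.rpow_ne_top_of_nonneg (by positivity) (by finiteness)) h2
  simpa using h3


lemma lsc_lintegral {Ω : Type*} [MeasurableSpace Ω] [TopologicalSpace Ω] [OpensMeasurableSpace Ω]
    {f : Ω → ℝ≥0∞} (hf : Continuous f) {P : ℕ → ProbabilityMeasure Ω} {Q : ProbabilityMeasure Ω}
    (h : Tendsto P atTop (𝓝 Q)) :
    ∫⁻ x, f x ∂(Q : Measure Ω) ≤ liminf (fun j => ∫⁻ x, f x ∂(P j : Measure Ω)) atTop := by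
  have hsup : ∀ x, f x = ⨆ n : ℕ, min (n : ℝ≥0∞) (f x) := by
    intro x
    rw [← iSup_inf_eq, ENNReal.iSup_natCast]
    simp
  have hmono : Monotone (fun (n : ℕ) x => min (n : ℝ≥0∞) (f x)) := by
    intro m n hmn x
    exact min_le_min (by exact_mod_cast hmn) le_rfl
  calc ∫⁻ x, f x ∂(Q : Measure Ω) = ∫⁻ x, ⨆ n : ℕ, min (n : ℝ≥0∞) (f x) ∂(Q : Measure Ω) :=
        lintegral_congr fun x => hsup x
    _ = ⨆ n : ℕ, ∫⁻ x, min (n : ℝ≥0∞) (f x) ∂(Q : Measure Ω) :=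
        lintegral_iSup (fun n => (continuous_const.min hf).measurable) hmono
    _ ≤ _ := by
      apply iSup_le
      intro n
      have hne : ∀ x, min (n : ℝ≥0∞) (f x) ≠ ⊤ := fun x =>
        ne_top_of_le_ne_top (ENNReal.natCast_ne_top n) (min_le_left _ _)
      have hc : Continuous (fun x => (min (n : ℝ≥0∞) (f x)).toNNReal) := by
        rw [continuous_iff_continuousAt]
        intro x
        exact (ENNReal.tendsto_toNNReal (hne x)).comp (continuous_const.min hf).continuousAt
      have hb : ∀ x, (min (n : ℝ≥0∞) (f x)).toNNReal ≤ (n : ℝ≥0) := by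
        intro x
        have := ENNReal.toNNReal_mono (ENNReal.natCast_ne_top n) (min_le_left (n : ℝ≥0∞) (f x))
        simpa using this
      let g : BoundedContinuousFunction Ω ℝ≥0 :=
        BoundedContinuousFunction.mkOfBound ⟨_, hc⟩ n (by
          intro x y
          have h1 := hb x
          have h2 := hb y
          rw [NNReal.dist_eq]
          have h1' : (((min (n : ℝ≥0∞) (f x)).toNNReal : ℝ≥0) : ℝ) ≤ n := by exact_mod_cast h1
          have h2' : (((min (n : ℝ≥0∞) (f y)).toNNReal : ℝ≥0) : ℝ) ≤ n := by exact_mod_cast h2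
          have p1 := ((min (n : ℝ≥0∞) (f x)).toNNReal).coe_nonneg
          have p2 := ((min (n : ℝ≥0∞) (f y)).toNNReal).coe_nonneg
          simp only [ContinuousMap.coe_mk]
          rw [abs_le]
          constructor <;> linarith)
      have hg : ∀ x, (g x : ℝ≥0∞) = min (n : ℝ≥0∞) (f x) := fun x => ENNReal.coe_toNNReal (hne x)
      have ht := ProbabilityMeasure.tendsto_iff_forall_lintegral_tendsto.1 h g
      simp only [hg] at ht
      rw [← ht.liminf_eq]
      exact liminf_le_liminf (Eventually.of_forall fun j => lintegral_mono fun x => min_le_right _ _)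

lemma energy_liminf {d : ℕ} {p q : ℝ} (hp2 : p < 0) (hq1 : 0 < q)
    {η : Measure (Eu d)} [IsProbabilityMeasure η] {ε : ℕ → ℝ} (hε0 : Tendsto ε atTop (𝓝 0))
    {P : ℕ → ProbabilityMeasure (Eu d)} {Q : ProbabilityMeasure (Eu d)}
    (h : Tendsto P atTop (𝓝 Q)) :
    energyE d (KE d p q) (Q : Measure (Eu d)) ≤
      liminf (fun j => energyE d (Kt d p q η (ε j)) (P j : Measure (Eu d))) atTop := by
  let f : ((Eu d × Eu d) × Eu d) × ℝ → ℝ≥0∞ := fun w => KE d p q (w.1.1.1 - w.1.1.2 - w.2 • w.1.2)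
  have hf : Continuous f := (continuous_KE hp2 hq1).comp (by fun_prop)
  let N : ProbabilityMeasure (Eu d) := ⟨η, inferInstance⟩
  have hform : ∀ (S : ProbabilityMeasure (Eu d)) (e : ℝ),
      ∫⁻ w, f w ∂((((S.prod S).prod N).prod (diracProba e) : ProbabilityMeasure _) :
        Measure (((Eu d × Eu d) × Eu d) × ℝ)) = energyE d (Kt d p q η e) (S : Measure (Eu d)) := by
    intro S e
    rw [energy_prod (measurable_Kt η e)]
    simp only [ProbabilityMeasure.toMeasure_prod]
    rw [lintegral_prod _ hf.measurable.aemeasurable]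
    have h1 : ∀ a : (Eu d × Eu d) × Eu d, ∫⁻ y, f (a, y) ∂((diracProba e : ProbabilityMeasure ℝ) :
        Measure ℝ) = f (a, e) := by
      intro a
      exact lintegral_dirac' _ (hf.measurable.comp (by fun_prop))
    simp only [h1]
    have hm : Measurable (fun a : (Eu d × Eu d) × Eu d => f (a, e)) :=
      hf.measurable.comp (by fun_prop)
    rw [lintegral_prod _ hm.aemeasurable]
    rfl
  have hPP : Tendsto (fun j => (((P j).prod (P j)).prod N).prod (diracProba (ε j))) atTop
      (𝓝 (((Q.prod Q).prod N).prod (diracProba 0))) := by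
    have a1 : Tendsto (fun j => (P j).prod (P j)) atTop (𝓝 (Q.prod Q)) :=
      (ProbabilityMeasure.continuous_prod.tendsto (Q, Q)).comp (h.prodMk_nhds h)
    have a2 : Tendsto (fun j => ((P j).prod (P j)).prod N) atTop (𝓝 ((Q.prod Q).prod N)) :=
      (ProbabilityMeasure.continuous_prod.tendsto (Q.prod Q, N)).comp
        (a1.prodMk_nhds tendsto_const_nhds)
    exact (ProbabilityMeasure.continuous_prod.tendsto ((Q.prod Q).prod N, diracProba 0)).comp
        (a2.prodMk_nhds ((continuous_diracProba.tendsto 0).comp hε0))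
  have hl := lsc_lintegral hf hPP
  simp only [hform] at hl
  refine le_trans (le_of_eq ?_) hl
  congr 1
  funext x
  simp [Kt]

lemma energy_translate {d : ℕ} {κ : Eu d → ℝ≥0∞} (hκ : Measurable κ) (μ : Measure (Eu d))
    [IsProbabilityMeasure μ] (y : Eu d) :
    energyE d κ (μ.map (fun x => x - y)) = energyE d κ μ := by
  unfold energyE
  have hm0 : Measurable (fun yz : Eu d × Eu d => κ (yz.1 - yz.2)) := hκ.comp (by fun_prop)
  have : IsProbabilityMeasure (μ.map (fun x => x - y)) :=
    Measure.isProbabilityMeasure_map (by fun_prop)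
  rw [lintegral_map hm0.lintegral_prod_right' (by fun_prop)]
  refine lintegral_congr fun x => ?_
  rw [lintegral_map (by fun_prop) (by fun_prop)]
  simp


lemma second_moment_eq {d : ℕ} (S : Measure (Eu d)) [IsProbabilityMeasure S] {R : ℝ}
    (h : ∀ᵐ x ∂S, ‖x‖ ≤ R) :
    ∫⁻ x, (‖x‖₊ : ℝ≥0∞) ^ 2 ∂S = ENNReal.ofReal (∫ x, min (‖x‖ ^ 2) (R ^ 2) ∂S) := by
  have hn : ∀ x : Eu d, 0 ≤ min (‖x‖ ^ 2) (R ^ 2) := fun x => le_min (by positivity) (by positivity)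
  have hi : Integrable (fun x : Eu d => min (‖x‖ ^ 2) (R ^ 2)) S := by
    refine Integrable.of_bound (C := R ^ 2) (by fun_prop) (Eventually.of_forall fun x => ?_)
    rw [Real.norm_of_nonneg (hn x)]
    exact min_le_right _ _
  rw [ofReal_integral_eq_lintegral_ofReal hi (Eventually.of_forall hn)]
  apply lintegral_congr_ae
  filter_upwards [h] with x hx
  have : ‖x‖ ^ 2 ≤ R ^ 2 := by gcongr
  rw [min_eq_left this, coe_nnnorm_eq, ENNReal.ofReal_pow (norm_nonneg _)]

/-- Convergence of minimizers: minimizers of `E_{ε_k}` converge, up to a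
subsequence and translations, in the `2`-Wasserstein sense (weak-* convergence plus
convergence of second moments) to a minimizer of `E` over `P₂(ℝ^d)`. -/
theorem convergence_of_minimizers
    (d : ℕ) (hd : 3 ≤ d) (p q : ℝ) (hp1 : 2 - (d : ℝ) ≤ p) (hp2 : p < 0)
    (hq1 : 0 < q) (hq2 : q ≤ 2)
    (φ : EuclideanSpace ℝ (Fin d) → ℝ) (hφ : IsMollifier d φ)
    (ε : ℕ → ℝ) (hεpos : ∀ k, 0 < ε k) (hε0 : Tendsto ε atTop (𝓝 0))
    (μ : ℕ → Measure (EuclideanSpace ℝ (Fin d)))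
    (hμP2 : ∀ k, IsP2 d (μ k))
    (hmin : ∀ k, ∀ ν : Measure (EuclideanSpace ℝ (Fin d)), IsP2 d ν →
      energyReg d p q φ (ε k) (μ k) ≤ energyReg d p q φ (ε k) ν) :
    ∃ ks : ℕ → ℕ, StrictMono ks ∧
      ∃ y : ℕ → EuclideanSpace ℝ (Fin d),
        ∃ ν : Measure (EuclideanSpace ℝ (Fin d)), IsP2 d ν ∧
          WeakStarTendsto d (fun j => Measure.map (fun x => x - y j) (μ (ks j))) ν ∧
          Tendsto
            (fun j => ∫⁻ x, (‖x‖₊ : ℝ≥0∞) ^ 2 ∂(Measure.map (fun x => x - y j) (μ (ks j))))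
            atTop (𝓝 (∫⁻ x, (‖x‖₊ : ℝ≥0∞) ^ 2 ∂ν)) ∧
          ∀ σ : Measure (EuclideanSpace ℝ (Fin d)), IsP2 d σ →
            energyE d (KE d p q) ν ≤ energyE d (KE d p q) σ := by
  have := m2_prob hφ
  obtain ⟨C, hC⟩ := m2_good hd hφ
  have hη : Mc d (m2 d φ) ≠ ⊤ := by
    have := m2_moment hd hφ
    simp [Mc, this.ne]
  obtain ⟨N, hN⟩ := eventually_atTop.1 (hε0.eventually (Iic_mem_nhds (show (0 : ℝ) < 1 by norm_num)))
  set e : ℕ → ℝ := fun k => ε (k + N) with he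
  have he1 : ∀ k, e k ≤ 1 := fun k => hN _ (by omega)
  have hepos : ∀ k, 0 < e k := fun k => hεpos _
  have he0 : Tendsto e atTop (𝓝 0) := hε0.comp (tendsto_add_atTop_nat N)
  have hreg : ∀ k σ, energyReg d p q φ (ε (k + N)) σ = energyE d (Kt d p q (m2 d φ) (e k)) σ := by
    intro k σ
    unfold energyReg
    congr 1
    funext x
    exact Kreg_eq hd hp1 hp2 hq1 hq2 hφ (hepos k) (he1 k) x
  have hmin' : ∀ k, ∀ σ : Measure (Eu d), IsP2 d σ →
      energyE d (Kt d p q (m2 d φ) (e k)) (μ (k + N)) ≤ energyE d (Kt d p q (m2 d φ) (e k)) σ := by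
    intro k σ hσ
    rw [← hreg, ← hreg]
    exact hmin _ σ hσ
  obtain ⟨R, hR⟩ := supp_bound hd hp1 hp2 hq1 hq2 hC hη
  choose x0 hx0 using fun k => hR (e k) (hepos k) (he1 k) (μ (k + N)) (hμP2 _) (hmin' k)
  have hprob : ∀ k, IsProbabilityMeasure (μ k) := fun k => (hμP2 k).1
  let P : ℕ → ProbabilityMeasure (Eu d) := fun k =>
    ⟨(μ (k + N)).map (fun x => x - x0 k), Measure.isProbabilityMeasure_map (by fun_prop)⟩
  have hPae : ∀ k, ∀ᵐ x ∂(P k : Measure (Eu d)), ‖x‖ ≤ R := by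
    intro k
    change ∀ᵐ x ∂((μ (k + N)).map (fun x => x - x0 k)), ‖x‖ ≤ R
    rw [ae_map_iff (by fun_prop) (measurableSet_le (by fun_prop) measurable_const)]
    exact hx0 k
  have hae : ∀ S : ProbabilityMeasure (Eu d), S (Metric.closedBall (0 : Eu d) R)ᶜ ≤ 0 ↔
      ∀ᵐ x ∂(S : Measure (Eu d)), ‖x‖ ≤ R := by
    intro S
    rw [nonpos_iff_eq_zero, ProbabilityMeasure.null_iff_toMeasure_null, ae_iff]
    have : (Metric.closedBall (0 : Eu d) R)ᶜ = {a | ¬‖a‖ ≤ R} := by ext a; simp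
    rw [this]
  have hcomp := isCompact_setOfPred_probabilityMeasure_mass_eq_compl_isCompact_le
    (E := Eu d) (u := fun _ => 0) (K := fun _ => Metric.closedBall (0 : Eu d) R)
    tendsto_const_nhds (fun _ => isCompact_closedBall _ _) (Or.inl inferInstance)
  obtain ⟨Q, hQ, ψ, hψ, hlim⟩ := hcomp.tendsto_subseq (x := P) (fun k n => (hae _).2 (hPae k))
  have hQae := (hae Q).1 (hQ 0)
  have hweak : WeakStarTendsto d (fun j => ((P (ψ j) : Measure (Eu d)))) (Q : Measure (Eu d)) := by
    intro f hf hM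
    obtain ⟨M, hM⟩ := hM
    exact ProbabilityMeasure.tendsto_iff_forall_integral_tendsto.1 hlim
      (BoundedContinuousFunction.ofNormedAddCommGroup f hf M hM)
  refine ⟨fun j => ψ j + N, fun a b hab => by have := hψ hab; dsimp only; omega,
    fun j => x0 (ψ j), Q, ⟨inferInstance, ?_⟩, hweak, ?_, ?_⟩
  · rw [second_moment_eq _ hQae]; exact ENNReal.ofReal_lt_top
  · change Tendsto (fun j => ∫⁻ x, (‖x‖₊ : ℝ≥0∞) ^ 2 ∂(P (ψ j) : Measure (Eu d))) atTop _
    rw [second_moment_eq _ hQae]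
    simp only [second_moment_eq _ (hPae _)]
    refine ENNReal.tendsto_ofReal (hweak (fun x => min (‖x‖ ^ 2) (R ^ 2)) (by fun_prop) ⟨R ^ 2, ?_⟩)
    intro x
    rw [abs_of_nonneg (le_min (by positivity) (by positivity))]
    exact min_le_right _ _
  · intro σ hσ
    by_cases hσE : energyE d (KE d p q) σ = ⊤
    · rw [hσE]; exact le_top
    have := hσ.1
    have hrec := (recovery hd hp1 hp2 hq1 hq2 hC hη hepos he1 he0 σ hσE).comp hψ.tendsto_atTop
    rw [← hrec.liminf_eq]
    refine (energy_liminf hp2 hq1 (η := m2 d φ) (he0.comp hψ.tendsto_atTop) hlim).trans ?_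
    refine liminf_le_liminf (Eventually.of_forall fun j => ?_)
    change energyE d (Kt d p q (m2 d φ) (e (ψ j)))
      ((μ (ψ j + N)).map (fun x => x - x0 (ψ j))) ≤ _
    rw [energy_translate (measurable_Kt _ _)]
    exact hmin' _ σ hσ
end
end

section
/- (Uniform support bound for minimizers.) There exist constants M > 0 and ε₀ > 0 such that for every 0 < ε < ε₀ and every minimizer μ_ε of E_ε over P_2(ℝ^d), the diameter of the support of μ_ε is at most M. -/
open MeasureTheory Filter
open scoped ENNReal Topology NNReal

noncomputable section

/-- Purely measure-theoretic core: a minimizer of an interaction energy whose kernel is large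
far away from the origin has controlled support. -/
lemma core_bound (d : ℕ) (k : EuclideanSpace ℝ (Fin d) → ℝ≥0∞) (C r : ℝ) (hC : 0 ≤ C) (hr : 0 < r)
    (hk : ∀ x, r ≤ ‖x‖ → ENNReal.ofReal (2 * C + 3) ≤ k x)
    (μ : Measure (EuclideanSpace ℝ (Fin d))) (hμ : IsP2 d μ)
    (hI : energyE d k μ ≤ ENNReal.ofReal C)
    (hmin : ∀ ν, IsP2 d ν → energyE d k μ ≤ energyE d k ν) :
    Metric.diam (msupport d μ) ≤ 4 * r := by
  obtain ⟨hprob, hmom⟩ := hμ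
  set L : ℝ≥0∞ := ENNReal.ofReal (2 * C + 3) with hL
  -- a centre
  obtain ⟨x0, hx0⟩ : ∃ x0, ∫⁻ y, k (x0 - y) ∂μ ≤ ENNReal.ofReal (C + 1) := by
    by_contra! hcon
    have h1 : ∫⁻ _x, ENNReal.ofReal (C + 1) ∂μ ≤ energyE d k μ :=
      lintegral_mono fun x => (hcon x).le
    rw [lintegral_const, measure_univ, mul_one] at h1
    have := h1.trans hI
    rw [ENNReal.ofReal_le_ofReal_iff hC] at this
    linarith
  set B := Metric.ball x0 r with hB
  set G := Metric.ball x0 (2 * r) with hG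
  have hBm : MeasurableSet B := measurableSet_ball
  have hGm : MeasurableSet G := measurableSet_ball
  have hBG : B ⊆ G := Metric.ball_subset_ball (by linarith)
  have hBc : L * μ Bᶜ ≤ ENNReal.ofReal (C + 1) := by
    refine le_trans ?_ hx0
    rw [← setLIntegral_const]
    refine le_trans (setLIntegral_mono' hBm.compl fun y hy => ?_) (setLIntegral_le_lintegral Bᶜ _)
    apply hk
    have : ¬ dist y x0 < r := hy
    rw [← dist_eq_norm, dist_comm]; linarith
  -- real numbers
  set b := (μ B).toReal with hb
  set m := (μ Gᶜ).toReal with hm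
  set s := (μ G).toReal with hs
  have e1 : (μ Bᶜ).toReal = 1 - b := by
    have := probReal_compl_eq_one_sub (μ := μ) hBm
    simpa [Measure.real] using this
  have e2 : m = 1 - s := by
    have := probReal_compl_eq_one_sub (μ := μ) hGm
    simpa [Measure.real] using this
  have hb2 : (2 * C + 3) * (1 - b) ≤ C + 1 := by
    have := ENNReal.toReal_mono ENNReal.ofReal_ne_top hBc
    rw [ENNReal.toReal_mul, e1, hL, ENNReal.toReal_ofReal (by linarith),
      ENNReal.toReal_ofReal (by linarith)] at this
    exact this
  have hbhalf : 1 / 2 ≤ b := by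
    by_contra! h
    nlinarith
  have hbs : b ≤ s := ENNReal.toReal_mono (measure_ne_top _ _) (measure_mono hBG)
  have hm0 : 0 ≤ m := ENNReal.toReal_nonneg
  have hs0 : μ G ≠ 0 := by
    intro h
    have : s = 0 := by rw [hs, h]; simp
    linarith
  have hst : μ G ≠ ⊤ := measure_ne_top _ _
  -- the competitor
  have key1 : energyE d k μ ≤ (μ G)⁻¹ * ((μ G)⁻¹ * ∫⁻ x in G, ∫⁻ y in G, k (x - y) ∂μ ∂μ) := by
    have hP2 : IsP2 d ((μ G)⁻¹ • μ.restrict G) := by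
      refine ⟨⟨?_⟩, ?_⟩
      · simp [ENNReal.inv_mul_cancel hs0 hst]
      · rw [lintegral_smul_measure, smul_eq_mul]
        refine ENNReal.mul_lt_top (ENNReal.inv_lt_top.2 (pos_iff_ne_zero.2 hs0)) ?_
        exact (setLIntegral_le_lintegral G _).trans_lt hmom
    refine (hmin _ hP2).trans (le_of_eq ?_)
    unfold energyE
    simp only [lintegral_smul_measure, smul_eq_mul]
    rw [lintegral_const_mul' _ _ (ENNReal.inv_ne_top.2 hs0)]
  have key2 : (∫⁻ x in G, ∫⁻ y in G, k (x - y) ∂μ ∂μ) + L * μ Gᶜ * μ B + L * μ B * μ Gᶜ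
      ≤ energyE d k μ := by
    have sp : ∀ x, ∫⁻ y, k (x - y) ∂μ = ∫⁻ y in G, k (x - y) ∂μ + ∫⁻ y in Gᶜ, k (x - y) ∂μ :=
      fun x => (lintegral_add_compl _ hGm).symm
    have far : ∀ x y, x ∈ G → x ∈ B → y ∈ Gᶜ → r ≤ ‖x - y‖ := by
      intro x y _ hx hy
      have h1 : dist x x0 < r := hx
      have h2 : ¬ dist y x0 < 2 * r := hy
      rw [← dist_eq_norm]
      have := dist_triangle y x x0
      rw [dist_comm y x] at this
      linarith
    have a1 : L * μ Gᶜ * μ B ≤ ∫⁻ x in G, ∫⁻ y in Gᶜ, k (x - y) ∂μ ∂μ := by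
      refine le_trans ?_ (lintegral_mono_set hBG)
      rw [← setLIntegral_const]
      refine setLIntegral_mono' hBm fun x hx => ?_
      rw [← setLIntegral_const]
      exact setLIntegral_mono' hGm.compl fun y hy => hk _ (far x y (hBG hx) hx hy)
    have a2 : L * μ B * μ Gᶜ ≤ ∫⁻ x in Gᶜ, ∫⁻ y, k (x - y) ∂μ ∂μ := by
      rw [← setLIntegral_const]
      refine setLIntegral_mono' hGm.compl fun x hx => ?_
      refine le_trans ?_ (setLIntegral_le_lintegral B _)
      rw [← setLIntegral_const]
      refine setLIntegral_mono' hBm fun y hy => hk _ ?_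
      rw [norm_sub_rev]
      exact far y x (hBG hy) hy hx
    have a3 : energyE d k μ = (∫⁻ x in G, ∫⁻ y, k (x - y) ∂μ ∂μ)
        + ∫⁻ x in Gᶜ, ∫⁻ y, k (x - y) ∂μ ∂μ := (lintegral_add_compl _ hGm).symm
    rw [a3]
    refine add_le_add ?_ a2
    simp_rw [sp]
    exact (add_le_add le_rfl a1).trans (le_lintegral_add _ _)
  set J := ∫⁻ x in G, ∫⁻ y in G, k (x - y) ∂μ ∂μ with hJ
  have hEt : energyE d k μ ≠ ⊤ := ne_top_of_le_ne_top ENNReal.ofReal_ne_top hI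
  have hJt : J ≠ ⊤ := by
    refine ne_top_of_le_ne_top hEt (le_trans ?_ key2)
    rw [add_assoc]; exact le_self_add
  set I := (energyE d k μ).toReal with hIdef
  have r1 : s * s * I ≤ J.toReal := by
    have h := ENNReal.toReal_mono (by
      refine ENNReal.mul_ne_top (ENNReal.inv_ne_top.2 hs0)
        (ENNReal.mul_ne_top (ENNReal.inv_ne_top.2 hs0) hJt)) key1
    rw [ENNReal.toReal_mul, ENNReal.toReal_mul, ENNReal.toReal_inv] at h
    have hspos : 0 < s := by linarith
    calc s * s * I ≤ s * s * (s⁻¹ * (s⁻¹ * J.toReal)) := by gcongr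
      _ = J.toReal := by field_simp
  have r2 : J.toReal + 2 * (2 * C + 3) * m * b ≤ I := by
    have h := ENNReal.toReal_mono hEt key2
    have t1 : L * μ Gᶜ * μ B ≠ ⊤ := ENNReal.mul_ne_top
      (ENNReal.mul_ne_top ENNReal.ofReal_ne_top (measure_ne_top _ _)) (measure_ne_top _ _)
    have t2 : L * μ B * μ Gᶜ ≠ ⊤ := ENNReal.mul_ne_top
      (ENNReal.mul_ne_top ENNReal.ofReal_ne_top (measure_ne_top _ _)) (measure_ne_top _ _)
    rw [ENNReal.toReal_add (ENNReal.add_ne_top.2 ⟨hJt, t1⟩) t2, ENNReal.toReal_add hJt t1] at h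
    simp only [ENNReal.toReal_mul] at h
    rw [hL, ENNReal.toReal_ofReal (by linarith)] at h
    change J.toReal + (2 * C + 3) * m * b + (2 * C + 3) * b * m ≤ I at h
    linarith
  have r3 : I ≤ C := by
    have h := ENNReal.toReal_mono ENNReal.ofReal_ne_top hI
    rwa [ENNReal.toReal_ofReal hC] at h
  have hI0 : 0 ≤ I := ENNReal.toReal_nonneg
  have hmz : m = 0 := by
    by_contra hne
    have hmp : 0 < m := lt_of_le_of_ne hm0 (Ne.symm hne)
    have hs1 : s = 1 - m := by linarith
    have h1 : (2 * C + 3) * m ≤ 2 * (2 * C + 3) * m * b := by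
      have : 0 ≤ (2 * C + 3) * m := by positivity
      nlinarith
    have h2 : (2 * C + 3) * m ≤ (1 - s * s) * I := by linarith
    have h3 : (1 - s * s) * I ≤ 2 * m * C := by
      have : 1 - s * s = 2 * m - m * m := by rw [hs1]; ring
      rw [this]
      nlinarith [mul_nonneg hm0 hI0, mul_nonneg (mul_nonneg hm0 hm0) hI0]
    nlinarith
  have hGz : μ Gᶜ = 0 := by
    rcases (ENNReal.toReal_eq_zero_iff _).1 hmz with h | h
    · exact h
    · exact absurd h (measure_ne_top _ _)
  have hsub : msupport d μ ⊆ Metric.closedBall x0 (2 * r) := by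
    intro x hx
    by_contra hcon
    have hd : 2 * r < dist x x0 := by simpa using hcon
    have hpos := hx (dist x x0 - 2 * r) (by linarith)
    have : Metric.ball x (dist x x0 - 2 * r) ⊆ Gᶜ := by
      intro y hy hyG
      have h1 : dist y x < dist x x0 - 2 * r := hy
      have h2 : dist y x0 < 2 * r := hyG
      have := dist_triangle x y x0
      rw [dist_comm x y] at this
      linarith
    exact absurd (measure_mono_null this hGz) hpos.ne'
  calc Metric.diam (msupport d μ) ≤ Metric.diam (Metric.closedBall x0 (2 * r)) :=
        Metric.diam_mono hsub Metric.isBounded_closedBall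
    _ ≤ 2 * (2 * r) := Metric.diam_closedBall (by linarith)
    _ = 4 * r := by ring


/-- The `[0,∞]`-valued truncation of the real kernel. -/
noncomputable def kE (d : ℕ) (p q : ℝ) (w : EuclideanSpace ℝ (Fin d)) : ℝ≥0∞ :=
  ENNReal.ofReal (Kfun d p q w)

/-- Squared norm in `[0,∞]`. -/
noncomputable def nsq (d : ℕ) (w : EuclideanSpace ℝ (Fin d)) : ℝ≥0∞ :=
  ENNReal.ofReal (‖w‖ ^ 2)

lemma measurable_Kfun (d : ℕ) (p q : ℝ) : Measurable (Kfun d p q) := by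
  unfold Kfun
  exact ((measurable_norm.pow_const q).div_const q).sub ((measurable_norm.pow_const p).div_const p)

lemma measurable_kE (d : ℕ) (p q : ℝ) : Measurable (kE d p q) :=
  (measurable_Kfun d p q).ennreal_ofReal

lemma measurable_nsq (d : ℕ) : Measurable (nsq d) :=
  (measurable_norm.pow_const 2).ennreal_ofReal

lemma Kfun_nonneg_s15 (d : ℕ) (p q : ℝ) (hp : p < 0) (hq : 0 < q) (w : EuclideanSpace ℝ (Fin d)) :
    0 ≤ Kfun d p q w := by
  unfold Kfun
  have h1 : 0 ≤ ‖w‖ ^ q / q := by positivity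
  have h2 : ‖w‖ ^ p / p ≤ 0 := div_nonpos_of_nonneg_of_nonpos (by positivity) hp.le
  linarith

lemma Kfun_ge (d : ℕ) (p q : ℝ) (hp : p < 0) (w : EuclideanSpace ℝ (Fin d)) :
    ‖w‖ ^ q / q ≤ Kfun d p q w := by
  unfold Kfun
  have h2 : ‖w‖ ^ p / p ≤ 0 := div_nonpos_of_nonneg_of_nonpos (by positivity) hp.le
  linarith

lemma kE_le (d : ℕ) (p q : ℝ) (hp : p < 0) (hq : 0 < q) (hq2 : q ≤ 2)
    (w : EuclideanSpace ℝ (Fin d)) :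
    kE d p q w ≤ ENNReal.ofReal ((-p)⁻¹) * ENNReal.ofReal (‖w‖ ^ p)
      + ENNReal.ofReal (q⁻¹) * (1 + nsq d w) := by
  unfold kE nsq
  have h0 : ‖w‖ ^ q ≤ 1 + ‖w‖ ^ 2 := by
    rcases le_total ‖w‖ 1 with h | h
    · have := Real.rpow_le_one (norm_nonneg w) h hq.le
      nlinarith [sq_nonneg ‖w‖]
    · have := Real.rpow_le_rpow_of_exponent_le h hq2
      rw [Real.rpow_two] at this
      linarith
  have hp' : 0 < (-p)⁻¹ := inv_pos.2 (by linarith)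
  have hq' : 0 < q⁻¹ := inv_pos.2 hq
  rw [← ENNReal.ofReal_one, ← ENNReal.ofReal_add zero_le_one (by positivity),
    ← ENNReal.ofReal_mul hp'.le, ← ENNReal.ofReal_mul hq'.le,
    ← ENNReal.ofReal_add (by positivity) (by positivity)]
  apply ENNReal.ofReal_le_ofReal
  unfold Kfun
  have e : ‖w‖ ^ q / q - ‖w‖ ^ p / p = (-p)⁻¹ * ‖w‖ ^ p + q⁻¹ * ‖w‖ ^ q := by
    have := hp.ne
    have := hq.ne'
    field_simp
    ring
  rw [e]
  gcongr

lemma nsq_sub_le (d : ℕ) (a b : EuclideanSpace ℝ (Fin d)) :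
    nsq d (a - b) ≤ 2 * nsq d a + 2 * nsq d b := by
  unfold nsq
  have h2 : ∀ t : ℝ, 2 * ENNReal.ofReal t = ENNReal.ofReal (2 * t) := by
    intro t
    rw [ENNReal.ofReal_mul (by norm_num)]
    simp
  rw [h2, h2, ← ENNReal.ofReal_add (by positivity) (by positivity)]
  apply ENNReal.ofReal_le_ofReal
  have h := norm_sub_le a b
  nlinarith [sq_nonneg (‖a‖ - ‖b‖), norm_nonneg (a - b), norm_nonneg a, norm_nonneg b]

/-- The local singularity integral. -/
noncomputable def Jsing (d : ℕ) (p : ℝ) : ℝ≥0∞ :=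
  ∫⁻ u in Metric.ball (0 : EuclideanSpace ℝ (Fin d)) 1, ENNReal.ofReal (‖u‖ ^ p)

lemma Jsing_lt_top (d : ℕ) (hd : 3 ≤ d) (p : ℝ) (hp1 : 2 - (d : ℝ) ≤ p) : Jsing d p < ⊤ := by
  have : Nonempty (Fin d) := ⟨⟨0, by omega⟩⟩
  have : Nontrivial (EuclideanSpace ℝ (Fin d)) := inferInstance
  have h : IntegrableOn (fun x : EuclideanSpace ℝ (Fin d) => ‖x‖ ^ p) (Metric.ball 0 1) volume := by
    rw [integrableOn_fun_norm_addHaar volume (f := fun t : ℝ => t ^ p)]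
    have h1 : IntegrableOn (fun y : ℝ => y ^ ((d : ℝ) - 1 + p)) (Set.Ioo 0 1) volume := by
      rw [intervalIntegral.integrableOn_Ioo_rpow_iff zero_lt_one]
      linarith
    refine h1.congr_fun (fun y hy => ?_) measurableSet_Ioo
    have hy0 : 0 < y := hy.1
    simp only [finrank_euclideanSpace, Fintype.card_fin, smul_eq_mul]
    rw [Real.rpow_add hy0]
    congr 1
    rw [← Real.rpow_natCast, Nat.cast_sub (by omega)]
    simp
  have := h.lintegral_lt_top
  exact this

/-- A probability density which is bounded and has second moment bounded by `M`. -/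
structure GoodDensity (d : ℕ) (g : EuclideanSpace ℝ (Fin d) → ℝ) (D : ℝ) (M : ℝ≥0∞) : Prop where
  meas : Measurable g
  nonneg : ∀ x, 0 ≤ g x
  bdd : ∀ x, g x ≤ D
  mass : ∫⁻ x, ENNReal.ofReal (g x) = 1
  mom : ∫⁻ x, ENNReal.ofReal (g x) * nsq d x ≤ M

/-- The law with density `g`. -/
noncomputable def law (d : ℕ) (g : EuclideanSpace ℝ (Fin d) → ℝ) :
    Measure (EuclideanSpace ℝ (Fin d)) :=
  volume.withDensity fun x => ENNReal.ofReal (g x)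

section good

variable {d : ℕ} {g : EuclideanSpace ℝ (Fin d) → ℝ} {D : ℝ} {M : ℝ≥0∞}

lemma GoodDensity.lint (hg : GoodDensity d g D M) {f : EuclideanSpace ℝ (Fin d) → ℝ≥0∞}
    (hf : Measurable f) : ∫⁻ x, f x ∂(law d g) = ∫⁻ x, ENNReal.ofReal (g x) * f x := by
  unfold law
  rw [lintegral_withDensity_eq_lintegral_mul _ hg.meas.ennreal_ofReal hf]
  rfl

lemma GoodDensity.prob (hg : GoodDensity d g D M) : IsProbabilityMeasure (law d g) :=
  ⟨by simp [law, hg.mass]⟩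

lemma GoodDensity.mom' (hg : GoodDensity d g D M) : ∫⁻ x, nsq d x ∂(law d g) ≤ M := by
  rw [hg.lint (measurable_nsq d)]; exact hg.mom

lemma GoodDensity.pot (hg : GoodDensity d g D M) (p : ℝ) (hp : p < 0)
    (a : EuclideanSpace ℝ (Fin d)) :
    ∫⁻ y, ENNReal.ofReal (‖a - y‖ ^ p) ∂(law d g) ≤ ENNReal.ofReal D * Jsing d p + 1 := by
  have := hg.prob
  set F : EuclideanSpace ℝ (Fin d) → ℝ≥0∞ :=
    (Metric.ball 0 1).indicator (fun u => ENNReal.ofReal (‖u‖ ^ p)) with hF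
  have hFm : Measurable F :=
    (measurable_norm.pow_const p).ennreal_ofReal.indicator measurableSet_ball
  have hFa : Measurable fun y => F (a - y) := hFm.comp (measurable_const.sub measurable_id)
  have h1 : ∀ y, ENNReal.ofReal (‖a - y‖ ^ p) ≤ F (a - y) + 1 := by
    intro y
    by_cases h : a - y ∈ Metric.ball (0 : EuclideanSpace ℝ (Fin d)) 1
    · rw [hF, Set.indicator_of_mem h]; exact le_self_add
    · refine le_trans ?_ le_add_self
      rw [← ENNReal.ofReal_one]
      apply ENNReal.ofReal_le_ofReal
      have : 1 ≤ ‖a - y‖ := by simpa using h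
      exact Real.rpow_le_one_of_one_le_of_nonpos this hp.le
  calc ∫⁻ y, ENNReal.ofReal (‖a - y‖ ^ p) ∂(law d g)
      ≤ ∫⁻ y, (F (a - y) + 1) ∂(law d g) := lintegral_mono h1
    _ = ∫⁻ y, F (a - y) ∂(law d g) + 1 := by
        rw [lintegral_add_left hFa]; simp
    _ ≤ ENNReal.ofReal D * Jsing d p + 1 := by
        gcongr
        rw [hg.lint hFa]
        calc ∫⁻ y, ENNReal.ofReal (g y) * F (a - y)
            ≤ ∫⁻ y, ENNReal.ofReal D * F (a - y) := by
              apply lintegral_mono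
              intro y
              dsimp only
              gcongr
              exact hg.bdd y
          _ = ENNReal.ofReal D * ∫⁻ y, F (a - y) := by
              rw [lintegral_const_mul _ hFa]
          _ = ENNReal.ofReal D * Jsing d p := by
              rw [lintegral_sub_left_eq_self F a, hF, lintegral_indicator measurableSet_ball]
              rfl

/-- Upper bound for the potential of a good law. -/
lemma GoodDensity.Kpot (hg : GoodDensity d g D M) (p q : ℝ) (hp : p < 0) (hq : 0 < q) (hq2 : q ≤ 2)
    (a : EuclideanSpace ℝ (Fin d)) :
    ∫⁻ y, kE d p q (a - y) ∂(law d g) ≤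
      ENNReal.ofReal ((-p)⁻¹) * (ENNReal.ofReal D * Jsing d p + 1)
      + ENNReal.ofReal (q⁻¹) * (1 + (2 * nsq d a + 2 * M)) := by
  have := hg.prob
  have hm1 : Measurable fun y : EuclideanSpace ℝ (Fin d) => ENNReal.ofReal (‖a - y‖ ^ p) :=
    (((measurable_const.sub measurable_id).norm).pow_const p).ennreal_ofReal
  have hm2 : Measurable fun y => (2 * nsq d a + 2 * nsq d y) :=
    ((measurable_nsq d).const_mul 2).const_add _
  calc ∫⁻ y, kE d p q (a - y) ∂(law d g)
      ≤ ∫⁻ y, (ENNReal.ofReal ((-p)⁻¹) * ENNReal.ofReal (‖a - y‖ ^ p)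
        + ENNReal.ofReal (q⁻¹) * (1 + (2 * nsq d a + 2 * nsq d y))) ∂(law d g) := by
          apply lintegral_mono
          intro y
          exact (kE_le d p q hp hq hq2 _).trans (add_le_add le_rfl (mul_le_mul' le_rfl
            (add_le_add le_rfl (nsq_sub_le d a y))))
    _ = ENNReal.ofReal ((-p)⁻¹) * ∫⁻ y, ENNReal.ofReal (‖a - y‖ ^ p) ∂(law d g)
        + ENNReal.ofReal (q⁻¹) * (1 + (2 * nsq d a + 2 * ∫⁻ y, nsq d y ∂(law d g))) := by
          rw [lintegral_add_left (hm1.const_mul _), lintegral_const_mul _ hm1,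
            lintegral_const_mul _ (hm2.const_add 1), lintegral_add_left measurable_const,
            lintegral_add_left measurable_const, lintegral_const_mul _ (measurable_nsq d)]
          simp
    _ ≤ _ := add_le_add (mul_le_mul' le_rfl (hg.pot p hp a)) (mul_le_mul' le_rfl
          (add_le_add le_rfl (add_le_add le_rfl (mul_le_mul' le_rfl hg.mom'))))

lemma measurable_inner (hg : GoodDensity d g D M) (p q : ℝ) (x : EuclideanSpace ℝ (Fin d)) :
    Measurable fun y => ∫⁻ z, kE d p q (x - y - z) ∂(law d g) := by
  have := hg.prob
  apply Measurable.lintegral_prod_right' (f := fun w : EuclideanSpace ℝ (Fin d) ×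
    EuclideanSpace ℝ (Fin d) => kE d p q (x - w.1 - w.2))
  exact (measurable_kE d p q).comp ((measurable_const.sub measurable_fst).sub measurable_snd)

end good

section good2

variable {d : ℕ} {g : EuclideanSpace ℝ (Fin d) → ℝ} {D : ℝ} {M : ℝ≥0∞}

/-- The double convolution, with respect to laws. -/
noncomputable def dconv (d : ℕ) (p q : ℝ) (g : EuclideanSpace ℝ (Fin d) → ℝ)
    (x : EuclideanSpace ℝ (Fin d)) : ℝ≥0∞ :=
  ∫⁻ y, ∫⁻ z, kE d p q (x - y - z) ∂(law d g) ∂(law d g)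

lemma ofReal_conv (hg : GoodDensity d g D M) (hM : M ≠ ⊤) (hd : 3 ≤ d) (p q : ℝ)
    (hp1 : 2 - (d : ℝ) ≤ p) (hp : p < 0) (hq : 0 < q) (hq2 : q ≤ 2)
    (x : EuclideanSpace ℝ (Fin d)) :
    ENNReal.ofReal (∫ y, ∫ z, g y * Kfun d p q (x - y - z) * g z) = dconv d p q g x := by
  have := hg.prob
  have hJ := (Jsing_lt_top d hd p hp1).ne
  set H : EuclideanSpace ℝ (Fin d) → ℝ≥0∞ :=
    fun y => ∫⁻ z, kE d p q (x - y - z) ∂(law d g) with hH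
  have hHm : Measurable H := measurable_inner hg p q x
  set c1 : ℝ≥0∞ := ENNReal.ofReal ((-p)⁻¹) * (ENNReal.ofReal D * Jsing d p + 1) with hc1
  have hc1t : c1 ≠ ⊤ := by
    refine ENNReal.mul_ne_top ENNReal.ofReal_ne_top (ENNReal.add_ne_top.2
      ⟨ENNReal.mul_ne_top ENNReal.ofReal_ne_top hJ, ENNReal.one_ne_top⟩)
  have hHb : ∀ y, H y ≤ c1 + ENNReal.ofReal (q⁻¹) * (1 + (2 * nsq d (x - y) + 2 * M)) :=
    fun y => hg.Kpot p q hp hq hq2 (x - y)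
  have h2M : 2 * M ≠ ⊤ := ENNReal.mul_ne_top (by simp) hM
  have hnt : ∀ w, 2 * nsq d w ≠ ⊤ := fun w => ENNReal.mul_ne_top (by simp) ENNReal.ofReal_ne_top
  have hHt : ∀ y, H y ≠ ⊤ := by
    intro y
    refine ne_top_of_le_ne_top ?_ (hHb y)
    exact ENNReal.add_ne_top.2 ⟨hc1t, ENNReal.mul_ne_top ENNReal.ofReal_ne_top
      (ENNReal.add_ne_top.2 ⟨ENNReal.one_ne_top, ENNReal.add_ne_top.2 ⟨hnt _, h2M⟩⟩)⟩
  have hHint : ∫⁻ y, H y ∂(law d g) ≠ ⊤ := by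
    have hm2 : Measurable fun y => (2 * nsq d x + 2 * nsq d y) :=
      ((measurable_nsq d).const_mul 2).const_add _
    have hb : ∀ y, H y ≤ c1 + ENNReal.ofReal (q⁻¹) *
        (1 + (2 * (2 * nsq d x + 2 * nsq d y) + 2 * M)) := fun y =>
      (hHb y).trans (add_le_add le_rfl (mul_le_mul' le_rfl (add_le_add le_rfl
        (add_le_add (mul_le_mul' le_rfl (nsq_sub_le d x y)) le_rfl))))
    refine ne_top_of_le_ne_top ?_ (lintegral_mono hb)
    rw [lintegral_add_left measurable_const,
      lintegral_const_mul _ (((hm2.const_mul 2).add_const _).const_add 1),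
      lintegral_add_left measurable_const, lintegral_add_right _ measurable_const,
      lintegral_const_mul _ hm2, lintegral_add_left measurable_const,
      lintegral_const_mul _ (measurable_nsq d)]
    simp only [lintegral_const, measure_univ, mul_one]
    have hmt : ∫⁻ y, nsq d y ∂(law d g) ≠ ⊤ := ne_top_of_le_ne_top hM hg.mom'
    refine ENNReal.add_ne_top.2 ⟨hc1t, ENNReal.mul_ne_top ENNReal.ofReal_ne_top
      (ENNReal.add_ne_top.2 ⟨ENNReal.one_ne_top, ENNReal.add_ne_top.2 ⟨?_, h2M⟩⟩)⟩
    exact ENNReal.mul_ne_top (by simp) (ENNReal.add_ne_top.2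
      ⟨hnt _, ENNReal.mul_ne_top (by simp) hmt⟩)
  have inner : ∀ y, ∫ z, g y * Kfun d p q (x - y - z) * g z = g y * (H y).toReal := by
    intro y
    have hm : Measurable fun z => Kfun d p q (x - y - z) :=
      (measurable_Kfun d p q).comp (measurable_const.sub measurable_id)
    have hmE : Measurable fun z => kE d p q (x - y - z) :=
      (measurable_kE d p q).comp (measurable_const.sub measurable_id)
    have e : ∀ z, g y * Kfun d p q (x - y - z) * g z = g y * (g z * Kfun d p q (x - y - z)) :=
      fun z => by ring
    simp_rw [e]
    rw [integral_const_mul, integral_eq_lintegral_of_nonneg_ae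
      (Eventually.of_forall fun z => mul_nonneg (hg.nonneg z) (Kfun_nonneg_s15 d p q hp hq _))
      (hg.meas.mul hm).aestronglyMeasurable, hH]
    dsimp only
    rw [hg.lint hmE]
    congr 2
    refine lintegral_congr fun z => ?_
    rw [ENNReal.ofReal_mul (hg.nonneg z)]
    rfl
  simp_rw [inner]
  rw [integral_eq_lintegral_of_nonneg_ae
      (Eventually.of_forall fun y => mul_nonneg (hg.nonneg y) ENNReal.toReal_nonneg)
      (hg.meas.mul hHm.ennreal_toReal).aestronglyMeasurable]
  have e2 : ∫⁻ y, ENNReal.ofReal (g y * (H y).toReal) = ∫⁻ y, H y ∂(law d g) := by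
    rw [hg.lint hHm]
    refine lintegral_congr fun y => ?_
    rw [ENNReal.ofReal_mul (hg.nonneg y), ENNReal.ofReal_toReal (hHt y)]
  rw [e2, ENNReal.ofReal_toReal hHint]
  rfl

/-- Lower bound for the double convolution away from the origin. -/
lemma dconv_ge (hg : GoodDensity d g D M) (p q : ℝ) (hp : p < 0) (hq : 0 < q)
    (ρ : ℝ) (hρ0 : 0 < ρ) (hρ : 2 * M ≤ ENNReal.ofReal (ρ ^ 2)) (hM : M ≠ ⊤) (T : ℝ) (hT : 0 ≤ T)
    (x : EuclideanSpace ℝ (Fin d)) (hx : 2 * ρ + T ≤ ‖x‖) :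
    ENNReal.ofReal (T ^ q / q / 4) ≤ dconv d p q g x := by
  have := hg.prob
  set B := Metric.ball (0 : EuclideanSpace ℝ (Fin d)) ρ with hB
  have hBm : MeasurableSet B := measurableSet_ball
  have hBc : ENNReal.ofReal (ρ ^ 2) * law d g Bᶜ ≤ M := by
    refine le_trans ?_ hg.mom'
    rw [← setLIntegral_const]
    refine le_trans (setLIntegral_mono' hBm.compl fun y hy => ?_) (setLIntegral_le_lintegral Bᶜ _)
    apply ENNReal.ofReal_le_ofReal
    have : ρ ≤ ‖y‖ := by
      have : y ∉ B := hy
      simpa [hB] using this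
    gcongr
  have hhalf : ENNReal.ofReal (1 / 2) ≤ law d g B := by
    have e1 : (law d g Bᶜ).toReal = 1 - (law d g B).toReal := by
      have := probReal_compl_eq_one_sub (μ := law d g) hBm
      simpa [Measure.real] using this
    have h1 := ENNReal.toReal_mono hM hBc
    have h2 := ENNReal.toReal_mono ENNReal.ofReal_ne_top hρ
    rw [ENNReal.toReal_mul, e1, ENNReal.toReal_ofReal (by positivity)] at h1
    rw [ENNReal.toReal_mul, ENNReal.toReal_ofReal (by positivity)] at h2
    rw [ENNReal.ofReal_le_iff_le_toReal (measure_ne_top _ _)]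
    have h2' : 2 * M.toReal ≤ ρ ^ 2 := by simpa using h2
    have hρ2 : 0 < ρ ^ 2 := by positivity
    by_contra! hcon
    nlinarith
  have hk : ∀ y ∈ B, ∀ z ∈ B, ENNReal.ofReal (T ^ q / q) ≤ kE d p q (x - y - z) := by
    intro y hy z hz
    apply ENNReal.ofReal_le_ofReal
    refine le_trans ?_ (Kfun_ge d p q hp _)
    have hy' : ‖y‖ < ρ := by simpa [hB] using hy
    have hz' : ‖z‖ < ρ := by simpa [hB] using hz
    have : T ≤ ‖x - y - z‖ := by
      have h1 := norm_sub_norm_le x y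
      have h2 := norm_sub_norm_le (x - y) z
      linarith
    gcongr
  have hfin : ENNReal.ofReal (T ^ q / q) * law d g B * law d g B ≤ dconv d p q g x := by
    unfold dconv
    refine le_trans ?_ (setLIntegral_le_lintegral B _)
    rw [← setLIntegral_const]
    refine setLIntegral_mono' hBm fun y hy => ?_
    refine le_trans ?_ (setLIntegral_le_lintegral B _)
    rw [← setLIntegral_const]
    exact setLIntegral_mono' hBm fun z hz => hk y hy z hz
  refine le_trans ?_ hfin
  have hTq : 0 ≤ T ^ q / q := by positivity
  calc ENNReal.ofReal (T ^ q / q / 4)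
      = ENNReal.ofReal (T ^ q / q) * ENNReal.ofReal (1 / 2) * ENNReal.ofReal (1 / 2) := by
        rw [← ENNReal.ofReal_mul hTq, ← ENNReal.ofReal_mul (by positivity)]
        congr 1; ring
    _ ≤ _ := by gcongr

/-- Energy upper bound of a good law `f` under the kernel regularized with another density. -/
lemma energy_le {f : EuclideanSpace ℝ (Fin d) → ℝ} {D' : ℝ} (hf : GoodDensity d f D' M)
    (hg : GoodDensity d g D M) (p q : ℝ) (hp : p < 0) (hq : 0 < q) (hq2 : q ≤ 2) :
    energyE d (dconv d p q g) (law d f) ≤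
      ENNReal.ofReal ((-p)⁻¹) * (ENNReal.ofReal D' * Jsing d p + 1)
      + ENNReal.ofReal (q⁻¹) * (1 + (2 * (2 * (2 * M + 2 * M) + 2 * M) + 2 * M)) := by
  have := hg.prob
  have := hf.prob
  set c1 : ℝ≥0∞ := ENNReal.ofReal ((-p)⁻¹) * (ENNReal.ofReal D' * Jsing d p + 1) with hc1
  have swap : ∀ x, ∫⁻ x', dconv d p q g (x - x') ∂(law d f)
      = ∫⁻ y, ∫⁻ z, ∫⁻ x', kE d p q (x - y - z - x') ∂(law d f) ∂(law d g) ∂(law d g) := by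
    intro x
    unfold dconv
    rw [lintegral_lintegral_swap]
    · refine lintegral_congr fun y => ?_
      rw [lintegral_lintegral_swap]
      · refine lintegral_congr fun z => lintegral_congr fun x' => ?_
        congr 1
        abel
      · apply Measurable.aemeasurable
        exact (measurable_kE d p q).comp
          (((measurable_const.sub measurable_fst).sub measurable_const).sub measurable_snd)
    · apply Measurable.aemeasurable
      apply Measurable.lintegral_prod_right' (f := fun w : (EuclideanSpace ℝ (Fin d) ×
        EuclideanSpace ℝ (Fin d)) × EuclideanSpace ℝ (Fin d) =>
          kE d p q (x - w.1.1 - w.1.2 - w.2))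
      exact (measurable_kE d p q).comp
        (((measurable_const.sub (measurable_fst.comp measurable_fst)).sub
          (measurable_snd.comp measurable_fst)).sub measurable_snd)
  unfold energyE
  simp_rw [swap]
  have hn := measurable_nsq d
  have b1 : ∀ x y z, ∫⁻ x', kE d p q (x - y - z - x') ∂(law d f)
      ≤ c1 + ENNReal.ofReal (q⁻¹) *
        (1 + (2 * (2 * (2 * nsq d x + 2 * nsq d y) + 2 * nsq d z) + 2 * M)) := by
    intro x y z
    refine (hf.Kpot p q hp hq hq2 (x - y - z)).trans ?_
    refine add_le_add le_rfl (mul_le_mul' le_rfl (add_le_add le_rfl (add_le_add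
      (mul_le_mul' le_rfl ?_) le_rfl)))
    refine (nsq_sub_le d _ _).trans (add_le_add (mul_le_mul' le_rfl ?_) le_rfl)
    exact nsq_sub_le d _ _
  have b2 : ∀ x y, ∫⁻ z, ∫⁻ x', kE d p q (x - y - z - x') ∂(law d f) ∂(law d g)
      ≤ c1 + ENNReal.ofReal (q⁻¹) *
        (1 + (2 * (2 * (2 * nsq d x + 2 * nsq d y) + 2 * M) + 2 * M)) := by
    intro x y
    refine (lintegral_mono (b1 x y)).trans ?_
    have hm : Measurable fun z => 2 * (2 * nsq d x + 2 * nsq d y) + 2 * nsq d z :=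
      (hn.const_mul 2).const_add _
    rw [lintegral_add_left measurable_const,
      lintegral_const_mul _ (((hm.const_mul 2).add_const _).const_add 1),
      lintegral_add_left measurable_const, lintegral_add_right _ measurable_const,
      lintegral_const_mul _ hm, lintegral_add_left measurable_const,
      lintegral_const_mul _ hn]
    simp only [lintegral_const, measure_univ, mul_one]
    exact add_le_add le_rfl (mul_le_mul' le_rfl (add_le_add le_rfl (add_le_add
      (mul_le_mul' le_rfl (add_le_add le_rfl (mul_le_mul' le_rfl hg.mom'))) le_rfl)))
  have b3 : ∀ x, ∫⁻ y, ∫⁻ z, ∫⁻ x', kE d p q (x - y - z - x') ∂(law d f) ∂(law d g) ∂(law d g)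
      ≤ c1 + ENNReal.ofReal (q⁻¹) *
        (1 + (2 * (2 * (2 * nsq d x + 2 * M) + 2 * M) + 2 * M)) := by
    intro x
    refine (lintegral_mono (b2 x)).trans ?_
    have hm : Measurable fun y => 2 * nsq d x + 2 * nsq d y :=
      (hn.const_mul 2).const_add _
    have hm' : Measurable fun y => 2 * (2 * nsq d x + 2 * nsq d y) + 2 * M :=
      (hm.const_mul 2).add_const _
    rw [lintegral_add_left measurable_const,
      lintegral_const_mul _ (((hm'.const_mul 2).add_const _).const_add 1),
      lintegral_add_left measurable_const, lintegral_add_right _ measurable_const,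
      lintegral_const_mul _ hm', lintegral_add_right _ measurable_const,
      lintegral_const_mul _ hm, lintegral_add_left measurable_const, lintegral_const_mul _ hn]
    simp only [lintegral_const, measure_univ, mul_one]
    exact add_le_add le_rfl (mul_le_mul' le_rfl (add_le_add le_rfl (add_le_add
      (mul_le_mul' le_rfl (add_le_add (mul_le_mul' le_rfl (add_le_add le_rfl
        (mul_le_mul' le_rfl hg.mom'))) le_rfl)) le_rfl)))
  refine (lintegral_mono b3).trans ?_
  have hm : Measurable fun x => 2 * nsq d x + 2 * M := (hn.const_mul 2).add_const _
  have hm' : Measurable fun x => 2 * (2 * nsq d x + 2 * M) + 2 * M :=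
    (hm.const_mul 2).add_const _
  rw [lintegral_add_left measurable_const,
    lintegral_const_mul _ (((hm'.const_mul 2).add_const _).const_add 1),
    lintegral_add_left measurable_const, lintegral_add_right _ measurable_const,
    lintegral_const_mul _ hm', lintegral_add_right _ measurable_const,
    lintegral_const_mul _ hm, lintegral_add_right _ measurable_const, lintegral_const_mul _ hn]
  simp only [lintegral_const, measure_univ, mul_one]
  exact add_le_add le_rfl (mul_le_mul' le_rfl (add_le_add le_rfl (add_le_add
    (mul_le_mul' le_rfl (add_le_add (mul_le_mul' le_rfl (add_le_add
      (mul_le_mul' le_rfl hf.mom') le_rfl)) le_rfl)) le_rfl)))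

end good2

lemma mollifier_bdd (d : ℕ) (φ : EuclideanSpace ℝ (Fin d) → ℝ) (hφ : IsMollifier d φ) :
    ∃ D : ℝ, ∀ x, φ x ≤ D := by
  obtain ⟨hs, -, hn, h1, C, hC, l, hl, hdec⟩ := hφ
  have hl4 : 4 ≤ l := (le_max_right _ _).trans hl
  obtain ⟨D0, hD0⟩ := (isCompact_closedBall (0 : EuclideanSpace ℝ (Fin d)) 1).exists_bound_of_continuousOn
    hs.continuous.continuousOn
  refine ⟨max D0 C, fun x => ?_⟩
  rcases le_total ‖x‖ 1 with h | h
  · have := hD0 x (by simpa using h)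
    exact (le_abs_self _).trans (this.trans (le_max_left _ _))
  · have hx : x ≠ 0 := by
      rintro rfl
      simp at h
      linarith
    refine (hdec x hx).trans (le_trans ?_ (le_max_right _ _))
    have := Real.rpow_le_one_of_one_le_of_nonpos h (by linarith : -l ≤ 0)
    nlinarith

lemma mollifier_integrable (d : ℕ) (φ : EuclideanSpace ℝ (Fin d) → ℝ) (hφ : IsMollifier d φ) :
    Integrable φ := by
  by_contra h
  have := integral_undef h
  rw [hφ.2.2.2.1] at this
  exact one_ne_zero this

lemma mollifier_mom (d : ℕ) (hd : 3 ≤ d) (φ : EuclideanSpace ℝ (Fin d) → ℝ)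
    (hφ : IsMollifier d φ) : Integrable fun x => φ x * ‖x‖ ^ 2 := by
  have hint := mollifier_integrable d φ hφ
  obtain ⟨hs, -, hn, h1, C, hC, l, hl, hdec⟩ := hφ
  have hd3 : (3 : ℝ) ≤ d := by exact_mod_cast hd
  have hl2 : 2 * (d : ℝ) + 1 ≤ l := (le_max_left _ _).trans hl
  have hJ : Integrable (fun x : EuclideanSpace ℝ (Fin d) => (1 + ‖x‖) ^ (-((d : ℝ) + 1))) volume := by
    apply integrable_one_add_norm
    simp
  refine Integrable.mono' (hint.add (hJ.const_mul (C * 2 ^ ((d : ℝ) + 1))))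
    (hs.continuous.mul (continuous_norm.pow 2)).aestronglyMeasurable (Eventually.of_forall fun x => ?_)
  rw [Real.norm_of_nonneg (mul_nonneg (hn x) (by positivity))]
  simp only [Pi.add_apply]
  rcases le_total ‖x‖ 1 with h | h
  · have h2 : ‖x‖ ^ 2 ≤ 1 := pow_le_one₀ (norm_nonneg _) h
    have h3 : φ x * ‖x‖ ^ 2 ≤ φ x := mul_le_of_le_one_right (hn x) h2
    have h4 : 0 ≤ C * 2 ^ ((d : ℝ) + 1) * (1 + ‖x‖) ^ (-((d : ℝ) + 1)) := by positivity
    linarith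
  · have hx0 : 0 < ‖x‖ := by linarith
    have hx : x ≠ 0 := norm_pos_iff.1 hx0
    have h2 : φ x * ‖x‖ ^ 2 ≤ C * ‖x‖ ^ (-((d : ℝ) + 1)) := by
      calc φ x * ‖x‖ ^ 2 ≤ C * ‖x‖ ^ (-l) * ‖x‖ ^ 2 := by
            gcongr
            exact hdec x hx
        _ = C * ‖x‖ ^ (-l + 2) := by
            rw [mul_assoc, Real.rpow_add hx0, Real.rpow_two]
        _ ≤ C * ‖x‖ ^ (-((d : ℝ) + 1)) := by
            gcongr
            linarith
    have h3 : ‖x‖ ^ (-((d : ℝ) + 1)) ≤ 2 ^ ((d : ℝ) + 1) * (1 + ‖x‖) ^ (-((d : ℝ) + 1)) := by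
      have e : ((1 + ‖x‖) / 2) ^ (-((d : ℝ) + 1))
          = 2 ^ ((d : ℝ) + 1) * (1 + ‖x‖) ^ (-((d : ℝ) + 1)) := by
        rw [Real.div_rpow (by positivity) (by norm_num), Real.rpow_neg (by norm_num : (0:ℝ) ≤ 2),
          div_inv_eq_mul, mul_comm]
      rw [← e]
      exact Real.rpow_le_rpow_of_nonpos (by positivity) (by linarith) (by linarith)
    have h4 : C * ‖x‖ ^ (-((d : ℝ) + 1))
        ≤ C * 2 ^ ((d : ℝ) + 1) * (1 + ‖x‖) ^ (-((d : ℝ) + 1)) := by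
      rw [mul_assoc]
      gcongr
    have := hn x
    linarith

lemma good_scaled (d : ℕ) (hd : 3 ≤ d) (φ : EuclideanSpace ℝ (Fin d) → ℝ)
    (hφ : IsMollifier d φ) (D : ℝ) (hD : ∀ x, φ x ≤ D) (ε : ℝ) (hε : 0 < ε) (hε1 : ε ≤ 1) :
    GoodDensity d (scaled d φ ε) ((ε ^ d)⁻¹ * D)
      (ENNReal.ofReal (∫ x, φ x * ‖x‖ ^ 2)) := by
  have hint := mollifier_integrable d φ hφ
  have hmom := mollifier_mom d hd φ hφ
  obtain ⟨hs, -, hn, h1, -⟩ := hφ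
  have hεd : 0 < ε ^ d := by positivity
  have hnn : ∀ x, 0 ≤ scaled d φ ε x := fun x => mul_nonneg (by positivity) (hn _)
  have hcont : Continuous (scaled d φ ε) := by
    unfold scaled
    exact continuous_const.mul (hs.continuous.comp (continuous_const_smul _))
  have hεi : ε⁻¹ ≠ 0 := by positivity
  have sint : Integrable (scaled d φ ε) := (hint.comp_smul hεi).const_mul _
  have fr : Module.finrank ℝ (EuclideanSpace ℝ (Fin d)) = d := by simp
  have eM : ∀ x, scaled d φ ε x * ‖x‖ ^ 2
      = (ε ^ d)⁻¹ * ε ^ 2 * (φ (ε⁻¹ • x) * ‖ε⁻¹ • x‖ ^ 2) := by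
    intro x
    unfold scaled
    rw [norm_smul, Real.norm_of_nonneg (by positivity)]
    field_simp
  refine ⟨hcont.measurable, hnn, fun x => ?_, ?_, ?_⟩
  · unfold scaled
    exact mul_le_mul_of_nonneg_left (hD _) (by positivity)
  · rw [← ofReal_integral_eq_lintegral_ofReal sint (Eventually.of_forall hnn)]
    unfold scaled
    rw [integral_const_mul, Measure.integral_comp_inv_smul volume φ ε, fr, h1, abs_of_pos hεd]
    simp [hεd.ne']
  · have hi : Integrable fun x => scaled d φ ε x * ‖x‖ ^ 2 := by
      simp_rw [eM]
      exact (hmom.comp_smul hεi).const_mul _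
    have e : ∀ x, ENNReal.ofReal (scaled d φ ε x) * nsq d x
        = ENNReal.ofReal (scaled d φ ε x * ‖x‖ ^ 2) := fun x => by
      rw [ENNReal.ofReal_mul (hnn x)]; rfl
    simp_rw [e]
    rw [← ofReal_integral_eq_lintegral_ofReal hi
      (Eventually.of_forall fun x => mul_nonneg (hnn x) (by positivity))]
    apply ENNReal.ofReal_le_ofReal
    simp_rw [eM]
    rw [integral_const_mul, Measure.integral_comp_inv_smul volume
      (fun x : EuclideanSpace ℝ (Fin d) => φ x * ‖x‖ ^ 2) ε, fr, abs_of_pos hεd, smul_eq_mul]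
    have hI : 0 ≤ ∫ x, φ x * ‖x‖ ^ 2 := integral_nonneg fun x => mul_nonneg (hn x) (by positivity)
    have e3 : (ε ^ d)⁻¹ * ε ^ 2 * (ε ^ d * ∫ x, φ x * ‖x‖ ^ 2) = ε ^ 2 * ∫ x, φ x * ‖x‖ ^ 2 := by
      field_simp
    rw [e3]
    exact mul_le_of_le_one_left hI (pow_le_one₀ hε.le hε1)

/-- Uniform support bound: there are `M > 0` and `ε₀ > 0` such that for
every `0 < ε < ε₀`, every minimizer of `E_ε` over `P₂(ℝ^d)` has support of diameter at
most `M`. -/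
theorem uniform_support_bound_minimizers
    (d : ℕ) (hd : 3 ≤ d) (p q : ℝ) (hp1 : 2 - (d : ℝ) ≤ p) (hp2 : p < 0)
    (hq1 : 0 < q) (hq2 : q ≤ 2)
    (φ : EuclideanSpace ℝ (Fin d) → ℝ) (hφ : IsMollifier d φ) :
    ∃ M : ℝ, 0 < M ∧ ∃ ε₀ : ℝ, 0 < ε₀ ∧ ∀ ε : ℝ, 0 < ε → ε < ε₀ →
      ∀ μ : Measure (EuclideanSpace ℝ (Fin d)), IsP2 d μ →
        (∀ ν : Measure (EuclideanSpace ℝ (Fin d)), IsP2 d ν →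
          energyReg d p q φ ε μ ≤ energyReg d p q φ ε ν) →
        Metric.diam (msupport d μ) ≤ M := by
  obtain ⟨D, hD⟩ := mollifier_bdd d φ hφ
  set m2 : ℝ := ∫ x, φ x * ‖x‖ ^ 2 with hm2
  have hm20 : 0 ≤ m2 := integral_nonneg fun x => mul_nonneg (hφ.2.2.1 x) (by positivity)
  set Mm : ℝ≥0∞ := ENNReal.ofReal m2 with hMm
  have hMt : Mm ≠ ⊤ := ENNReal.ofReal_ne_top
  have h2t : ∀ a : ℝ≥0∞, a ≠ ⊤ → 2 * a ≠ ⊤ := fun a ha => ENNReal.mul_ne_top (by simp) ha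
  have good := good_scaled d hd φ hφ D hD
  have hf := good 1 one_pos le_rfl
  set D1 : ℝ := ((1 : ℝ) ^ d)⁻¹ * D with hD1
  set CE : ℝ≥0∞ := ENNReal.ofReal ((-p)⁻¹) * (ENNReal.ofReal D1 * Jsing d p + 1)
      + ENNReal.ofReal (q⁻¹) * (1 + (2 * (2 * (2 * Mm + 2 * Mm) + 2 * Mm) + 2 * Mm)) with hCE
  have hCEt : CE ≠ ⊤ := by
    have hJ := (Jsing_lt_top d hd p hp1).ne
    refine ENNReal.add_ne_top.2 ⟨ENNReal.mul_ne_top ENNReal.ofReal_ne_top (ENNReal.add_ne_top.2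
      ⟨ENNReal.mul_ne_top ENNReal.ofReal_ne_top hJ, ENNReal.one_ne_top⟩),
      ENNReal.mul_ne_top ENNReal.ofReal_ne_top (ENNReal.add_ne_top.2 ⟨ENNReal.one_ne_top, ?_⟩)⟩
    have a0 := h2t _ hMt
    have a1 := h2t _ (ENNReal.add_ne_top.2 ⟨a0, a0⟩)
    have a2 := h2t _ (ENNReal.add_ne_top.2 ⟨a1, a0⟩)
    exact ENNReal.add_ne_top.2 ⟨a2, a0⟩
  set C : ℝ := CE.toReal with hC
  have hC0 : 0 ≤ C := ENNReal.toReal_nonneg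
  set ρ : ℝ := 2 * m2 + 1 with hρ
  have hρ0 : 0 < ρ := by positivity
  set T : ℝ := (4 * q * (2 * C + 3)) ^ (1 / q) with hT
  have hT0 : 0 ≤ T := by positivity
  have hTq : T ^ q / q / 4 = 2 * C + 3 := by
    rw [hT, ← Real.rpow_mul (by positivity), one_div_mul_cancel hq1.ne', Real.rpow_one]
    field_simp
  have hρM : 2 * Mm ≤ ENNReal.ofReal (ρ ^ 2) := by
    have : 2 * Mm = ENNReal.ofReal (2 * m2) := by
      rw [ENNReal.ofReal_mul (by norm_num)]; simp [hMm]
    rw [this]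
    apply ENNReal.ofReal_le_ofReal
    rw [hρ]; nlinarith
  have hr0 : 0 < 2 * ρ + T := by linarith
  refine ⟨4 * (2 * ρ + T), by linarith, 1, one_pos, fun ε hε hε1 μ hμ hmin => ?_⟩
  have hg := good ε hε hε1.le
  have hk : (fun x => ENNReal.ofReal (Kreg d p q φ ε x)) = dconv d p q (scaled d φ ε) := by
    funext x
    exact ofReal_conv hg hMt hd p q hp1 hp2 hq1 hq2 x
  unfold energyReg at hmin
  rw [hk] at hmin
  refine core_bound d (dconv d p q (scaled d φ ε)) C (2 * ρ + T) hC0 hr0 ?_ μ hμ ?_ hmin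
  · intro x hx
    rw [← hTq]
    exact dconv_ge hg p q hp2 hq1 ρ hρ0 hρM hMt T hT0 x hx
  · have hP2 : IsP2 d (law d (scaled d φ 1)) := by
      refine ⟨hf.prob, lt_of_le_of_lt ?_ hMt.lt_top⟩
      refine le_trans (le_of_eq ?_) hf.mom'
      refine lintegral_congr fun x => ?_
      unfold nsq
      rw [ENNReal.ofReal_pow (norm_nonneg _), ofReal_norm]
      rfl
    refine (hmin _ hP2).trans ?_
    rw [hC, ENNReal.ofReal_toReal hCEt]
    exact energy_le hf hg p q hp2 hq1 hq2
end
end
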